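/- arXiv:1703.04942 — 10 statements merged into one kernel-verified Lean document; each statement's English description precedes it below -/
import Mathlib

section
/- Let λ > 0, μ > 0 and u ∈ L¹(ℝ, ℂ). Define the left tempered fractional integral (TI^{μ,λ}u)(x) := (1/Γ(μ)) ∫_{−∞}^x e^{−λ(x−y)} (x−y)^{μ−1} u(y) dy, which is defined for almost every x and belongs to L¹(ℝ). Then for every ω ∈ ℝ, ∫_ℝ (TI^{μ,λ}u)(x) e^{−iωx} dx = (λ + iω)^{−μ} · ∫_ℝ u(x) e^{−iωx} dx, where (λ + iω)^{−μ} is the principal-branch complex power. -/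
open MeasureTheory

/-- The left tempered fractional integral of order μ with tempering parameter λ
of a complex-valued function u on ℝ:
(TI^{μ,λ}u)(x) = (1/Γ(μ)) ∫_{−∞}^x e^{−λ(x−y)} (x−y)^{μ−1} u(y) dy. -/
noncomputable def temperedIntL (lam mu : ℝ) (u : ℝ → ℂ) (x : ℝ) : ℂ :=
  ((1 / Real.Gamma mu : ℝ) : ℂ) *
    ∫ y in Set.Iio x, ((Real.exp (-(lam * (x - y))) * (x - y) ^ (mu - 1) : ℝ) : ℂ) * u y

/-- The integrand of the complex Gamma integral, extended by zero to the negative half-line. -/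
noncomputable def gammaKernel (a z : ℂ) : ℝ → ℂ :=
  (Set.Ioi (0 : ℝ)).indicator fun t => (t : ℂ) ^ (a - 1) * Complex.exp (-(z * t))

lemma norm_cpow_mul_exp_neg_mul (a z : ℂ) {t : ℝ} (ht : 0 < t) :
    ‖(t : ℂ) ^ a * Complex.exp (-(z * t))‖ = t ^ a.re * Real.exp (-z.re * t) := by
  rw [norm_mul, Complex.norm_cpow_eq_rpow_re_of_pos ht, Complex.norm_exp]
  simp

lemma integrableOn_rpow_mul_exp_neg_mul {s b : ℝ} (hs : -1 < s) (hb : 0 < b) :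
    IntegrableOn (fun t : ℝ => t ^ s * Real.exp (-b * t)) (Set.Ioi 0) := by
  simpa using integrableOn_rpow_mul_exp_neg_mul_rpow hs one_pos hb

lemma aestronglyMeasurable_cpow_mul_exp_neg_mul (a z : ℂ) :
    AEStronglyMeasurable (fun t : ℝ => (t : ℂ) ^ a * Complex.exp (-(z * t)))
      (volume.restrict (Set.Ioi 0)) :=
  Measurable.aestronglyMeasurable (by fun_prop)

lemma integrableOn_cpow_mul_exp_neg_mul {a z : ℂ} (ha : -1 < a.re) (hz : 0 < z.re) :
    IntegrableOn (fun t : ℝ => (t : ℂ) ^ a * Complex.exp (-(z * t))) (Set.Ioi 0) := by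
  refine (integrableOn_rpow_mul_exp_neg_mul ha hz).mono'
    (aestronglyMeasurable_cpow_mul_exp_neg_mul a z) ?_
  filter_upwards [ae_restrict_mem measurableSet_Ioi] with t ht
  exact (norm_cpow_mul_exp_neg_mul a z ht).le

lemma integrable_gammaKernel {a z : ℂ} (ha : 0 < a.re) (hz : 0 < z.re) :
    Integrable (gammaKernel a z) :=
  (integrableOn_cpow_mul_exp_neg_mul (by simpa using ha) hz).integrable_indicator
    measurableSet_Ioi

lemma differentiableAt_integral_cpow_mul_exp_neg_mul {a z : ℂ} (ha : 0 < a.re) (hz : 0 < z.re) :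
    DifferentiableAt ℂ
      (fun z => ∫ t : ℝ in Set.Ioi 0, (t : ℂ) ^ (a - 1) * Complex.exp (-(z * t))) z := by
  have hmem : {w : ℂ | z.re / 2 < w.re} ∈ nhds z :=
    (isOpen_lt continuous_const Complex.continuous_re).mem_nhds (by simpa using hz)
  refine (hasDerivAt_integral_of_dominated_loc_of_deriv_le hmem
    (F' := fun w t => (t : ℂ) ^ (a - 1) * (Complex.exp (-(w * t)) * -t))
    (bound := fun t => t ^ a.re * Real.exp (-(z.re / 2) * t))
    (.of_forall fun w => aestronglyMeasurable_cpow_mul_exp_neg_mul _ w)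
    (integrableOn_cpow_mul_exp_neg_mul (by simpa using ha) hz)
    (Measurable.aestronglyMeasurable (by fun_prop)) ?_
    (integrableOn_rpow_mul_exp_neg_mul (by linarith) (by linarith))
    (.of_forall fun t w _ => ?_)).2.differentiableAt
  · filter_upwards [ae_restrict_mem measurableSet_Ioi] with t (ht : 0 < t) w (hw : _ < _)
    rw [← mul_assoc, norm_mul, norm_cpow_mul_exp_neg_mul _ _ ht, norm_neg, Complex.norm_real,
      Real.norm_of_nonneg ht.le, mul_right_comm, Complex.sub_re, Complex.one_re,
      Real.rpow_sub_one ht.ne', div_mul_cancel₀ _ ht.ne']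
    gcongr
  · have h : HasDerivAt (fun w : ℂ => -(w * t)) (-t : ℂ) w := by
      simpa using (hasDerivAt_mul_const (t : ℂ)).fun_neg
    exact h.cexp.const_mul _

/-- The Gamma integral with complex exponent and complex scale. -/
lemma integral_cpow_mul_exp_neg_complex_mul_Ioi {a z : ℂ} (ha : 0 < a.re) (hz : 0 < z.re) :
    ∫ t : ℝ in Set.Ioi 0, (t : ℂ) ^ (a - 1) * Complex.exp (-(z * t)) =
      z ^ (-a) * Complex.Gamma a := by
  have hopen : IsOpen {w : ℂ | 0 < w.re} := isOpen_lt continuous_const Complex.continuous_re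
  have hF : AnalyticOnNhd ℂ
      (fun z => ∫ t : ℝ in Set.Ioi 0, (t : ℂ) ^ (a - 1) * Complex.exp (-(z * t)))
      {w : ℂ | 0 < w.re} :=
    DifferentiableOn.analyticOnNhd (fun w hw =>
      (differentiableAt_integral_cpow_mul_exp_neg_mul ha hw).differentiableWithinAt) hopen
  have hG : AnalyticOnNhd ℂ (fun z => z ^ (-a) * Complex.Gamma a) {w : ℂ | 0 < w.re} :=
    DifferentiableOn.analyticOnNhd (fun w hw =>
      ((differentiableAt_id.cpow_const (Or.inl hw)).mul_const _).differentiableWithinAt) hopen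
  refine hF.eqOn_of_preconnected_of_frequently_eq hG (convex_halfSpace_re_gt 0).isPreconnected
    (z₀ := 1) (by simp) ?_ hz
  have htendsto : Filter.Tendsto (fun r : ℝ => (r : ℂ)) (nhdsWithin 1 {1}ᶜ)
      (nhdsWithin 1 {1}ᶜ) := by
    refine tendsto_nhdsWithin_iff.2 ⟨?_, ?_⟩
    · exact (Complex.continuous_ofReal.tendsto' 1 1 (by simp)).mono_left nhdsWithin_le_nhds
    · filter_upwards [self_mem_nhdsWithin] with r hr
      simpa using hr
  refine htendsto.frequently (Filter.Eventually.frequently ?_)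
  filter_upwards [nhdsWithin_le_nhds (lt_mem_nhds (one_pos : (0 : ℝ) < 1))] with r hr
  rw [Complex.integral_cpow_mul_exp_neg_mul_Ioi ha hr, one_div, Complex.cpow_neg,
    Complex.inv_cpow _ _ (by rw [Complex.arg_ofReal_of_nonneg hr.le]; exact Real.pi_pos.ne)]

open scoped Convolution in
lemma temperedIntL_mul_exp_eq_convolution (lam mu : ℝ) (u : ℝ → ℂ) (ω x : ℝ) :
    temperedIntL lam mu u x * Complex.exp (-(Complex.I * ω * x)) =
      ((1 / Real.Gamma mu : ℝ) : ℂ) *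
        ((fun y : ℝ => u y * Complex.exp (-(Complex.I * ω * y)))
          ⋆[ContinuousLinearMap.mul ℝ ℂ] gammaKernel mu (lam + Complex.I * ω)) x := by
  rw [temperedIntL, mul_assoc, ← integral_mul_const, convolution_def,
    ← integral_indicator measurableSet_Iio]
  congr 2 with y
  by_cases hy : y < x
  · have hxy : 0 < x - y := sub_pos.2 hy
    have hexp : Complex.exp (-(lam * (x - y))) * Complex.exp (-(Complex.I * ω * x)) =
        Complex.exp (-(Complex.I * ω * y)) *
          Complex.exp (-((lam + Complex.I * ω) * (x - y))) := by
      rw [← Complex.exp_add, ← Complex.exp_add]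
      ring_nf
    simp only [gammaKernel, Set.indicator_of_mem (Set.mem_Iio.2 hy),
      Set.indicator_of_mem (Set.mem_Ioi.2 hxy), ContinuousLinearMap.mul_apply']
    push_cast [Complex.ofReal_cpow hxy.le]
    linear_combination ((x : ℂ) - y) ^ ((mu : ℂ) - 1) * u y * hexp
  · simp [gammaKernel, hy]

lemma integrable_mul_exp_neg_I_mul {u : ℝ → ℂ} (hu : Integrable u) (ω : ℝ) :
    Integrable fun x : ℝ => u x * Complex.exp (-(Complex.I * ω * x)) :=
  hu.mul_bdd (c := 1) (Measurable.aestronglyMeasurable (by fun_prop))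
    (.of_forall fun x => by simp [Complex.norm_exp])

/-- for λ > 0, μ > 0 and u ∈ L¹(ℝ,ℂ), the left tempered fractional
integral TI^{μ,λ}u belongs to L¹(ℝ) and its Fourier transform satisfies
F[TI^{μ,λ}u](ω) = (λ + iω)^{−μ} · F[u](ω) for every ω ∈ ℝ. -/
theorem temperedIntL_fourier (lam mu : ℝ) (hlam : 0 < lam) (hmu : 0 < mu)
    (u : ℝ → ℂ) (hu : Integrable u) :
    Integrable (temperedIntL lam mu u) ∧
      ∀ ω : ℝ,
        (∫ x : ℝ, temperedIntL lam mu u x * Complex.exp (-(Complex.I * ω * x))) =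
          ((lam : ℂ) + Complex.I * ω) ^ (-(mu : ℂ)) *
            ∫ x : ℝ, u x * Complex.exp (-(Complex.I * ω * x)) := by
  have hmu' : 0 < (mu : ℂ).re := by simpa using hmu
  have hlam' (ω : ℝ) : 0 < (lam + Complex.I * ω : ℂ).re := by simpa using hlam
  refine ⟨?_, fun ω => ?_⟩
  · have h := ((integrable_mul_exp_neg_I_mul hu 0).integrable_convolution
      (ContinuousLinearMap.mul ℝ ℂ) (integrable_gammaKernel hmu' (hlam' 0))).const_mul
      ((1 / Real.Gamma mu : ℝ) : ℂ)
    simp_rw [← temperedIntL_mul_exp_eq_convolution] at h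
    simpa using h
  · have hGamma : (Real.Gamma mu : ℂ) ≠ 0 := by
      exact_mod_cast (Real.Gamma_pos_of_pos hmu).ne'
    simp_rw [temperedIntL_mul_exp_eq_convolution]
    rw [integral_const_mul, integral_convolution _ (integrable_mul_exp_neg_I_mul hu ω)
      (integrable_gammaKernel hmu' (hlam' ω)), ContinuousLinearMap.mul_apply']
    simp only [gammaKernel]
    rw [integral_indicator measurableSet_Ioi,
      integral_cpow_mul_exp_neg_complex_mul_Ioi hmu' (hlam' ω), Complex.Gamma_ofReal]
    push_cast
    field_simp
end

section
/- Let α > −1, μ > 0, n ∈ ℕ and x > 0. Then (1/Γ(μ)) ∫₀^x (x−t)^{μ−1} t^α L_n^{(α)}(t) dt = (Γ(n+1+α)/Γ(n+1+α+μ)) · x^{α+μ} · L_n^{(α+μ)}(x). -/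
/-- The generalized Laguerre polynomial
L_n^{(α)}(x) = ∑_{j=0}^n (−1)^j (Γ(n+α+1)/(Γ(j+α+1)Γ(n−j+1))) x^j / j!. -/
noncomputable def lagL (α : ℝ) (n : ℕ) (x : ℝ) : ℝ :=
  ∑ j ∈ Finset.range (n + 1),
    (-1 : ℝ) ^ j *
      (Real.Gamma ((n : ℝ) + α + 1) /
        (Real.Gamma ((j : ℝ) + α + 1) * Real.Gamma (((n - j : ℕ) : ℝ) + 1))) *
      x ^ j / (Nat.factorial j : ℝ)

/-- Euler's beta integral over the interval from `0` to `x`. -/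
theorem integral_rpow_mul_sub_rpow {s t x : ℝ} (hs : 0 < s) (ht : 0 < t) (hx : 0 < x) :
    ∫ u in (0 : ℝ)..x, u ^ (s - 1) * (x - u) ^ (t - 1) =
      x ^ (s + t - 1) * (Real.Gamma s * Real.Gamma t / Real.Gamma (s + t)) := by
  have h := Complex.betaIntegral_scaled s t hx
  rw [Complex.betaIntegral_eq_Gamma_mul_div _ _ (by simpa) (by simpa), ← Complex.ofReal_add,
    Complex.Gamma_ofReal, Complex.Gamma_ofReal, Complex.Gamma_ofReal, ← Complex.ofReal_one,
    ← Complex.ofReal_sub (s + t), ← Complex.ofReal_cpow hx.le] at h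
  apply Complex.ofReal_injective
  push_cast
  push_cast at h
  rw [← h, ← intervalIntegral.integral_ofReal]
  refine intervalIntegral.integral_congr fun u hu => ?_
  rw [Set.uIcc_of_le hx.le] at hu
  simp only [Complex.ofReal_mul]
  rw [Complex.ofReal_cpow hu.1, Complex.ofReal_cpow (sub_nonneg.2 hu.2)]
  push_cast
  rfl

theorem intervalIntegrable_rpow_mul_sub_rpow {s t x : ℝ} (hs : 0 < s) (ht : 0 < t)
    (hx : 0 < x) :
    IntervalIntegrable (fun u : ℝ => u ^ (s - 1) * (x - u) ^ (t - 1))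
      MeasureTheory.volume 0 x := by
  by_contra h
  have h0 := integral_rpow_mul_sub_rpow hs ht hx
  rw [intervalIntegral.integral_undef h] at h0
  have := Real.Gamma_pos_of_pos hs
  have := Real.Gamma_pos_of_pos ht
  have := Real.Gamma_pos_of_pos (add_pos hs ht)
  exact absurd h0 (by positivity)

/-- for α > −1, μ > 0, n ∈ ℕ, x > 0:
(1/Γ(μ)) ∫₀^x (x−t)^{μ−1} t^α L_n^{(α)}(t) dt
  = (Γ(n+1+α)/Γ(n+1+α+μ)) x^{α+μ} L_n^{(α+μ)}(x). -/
theorem fracInt_lagL (α mu : ℝ) (hα : -1 < α) (hmu : 0 < mu) (n : ℕ) (x : ℝ) (hx : 0 < x) :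
    (1 / Real.Gamma mu) * ∫ t in (0 : ℝ)..x, (x - t) ^ (mu - 1) * (t ^ α * lagL α n t)
      = (Real.Gamma ((n : ℝ) + 1 + α) / Real.Gamma ((n : ℝ) + 1 + α + mu)) *
          x ^ (α + mu) * lagL (α + mu) n x := by
  have hs (j : ℕ) : 0 < (j : ℝ) + α + 1 := by
    have : (0 : ℝ) ≤ j := j.cast_nonneg
    linarith
  let c (j : ℕ) : ℝ := (-1 : ℝ) ^ j *
    (Real.Gamma ((n : ℝ) + α + 1) /
      (Real.Gamma ((j : ℝ) + α + 1) * Real.Gamma (((n - j : ℕ) : ℝ) + 1))) /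
    (Nat.factorial j : ℝ)
  have hint : ∫ t in (0 : ℝ)..x, (x - t) ^ (mu - 1) * (t ^ α * lagL α n t) =
      ∫ t in (0 : ℝ)..x, ∑ j ∈ Finset.range (n + 1),
        c j * (t ^ ((j : ℝ) + α + 1 - 1) * (x - t) ^ (mu - 1)) := by
    refine intervalIntegral.integral_congr_ae (Filter.Eventually.of_forall fun t ht => ?_)
    rw [Set.uIoc_of_le hx.le] at ht
    simp only [lagL, Finset.mul_sum]
    refine Finset.sum_congr rfl fun j _ => ?_
    rw [add_sub_cancel_right, Real.rpow_add ht.1, Real.rpow_natCast]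
    simp only [c]
    ring
  rw [hint, intervalIntegral.integral_finsetSum fun j _ =>
    (intervalIntegrable_rpow_mul_sub_rpow (hs j) hmu hx).const_mul _, lagL,
    Finset.mul_sum, Finset.mul_sum]
  refine Finset.sum_congr rfl fun j _ => ?_
  rw [intervalIntegral.integral_const_mul, integral_rpow_mul_sub_rpow (hs j) hmu hx,
    show (j : ℝ) + α + 1 + mu - 1 = α + mu + j by ring, Real.rpow_add hx, Real.rpow_natCast,
    show (n : ℝ) + 1 + α + mu = n + (α + mu) + 1 by ring,
    show (n : ℝ) + 1 + α = n + α + 1 by ring,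
    show (j : ℝ) + α + 1 + mu = j + (α + mu) + 1 by ring]
  have hΓmu := (Real.Gamma_pos_of_pos hmu).ne'
  have hΓj := (Real.Gamma_pos_of_pos (hs j)).ne'
  have hΓn : Real.Gamma ((n : ℝ) + (α + mu) + 1) ≠ 0 :=
    (Real.Gamma_pos_of_pos (by linarith [hs n])).ne'
  simp only [c]
  field_simp
end

section
/- Let k ∈ ℕ with k ≥ 1, μ ∈ [k−1, k), α > μ−1, n ∈ ℕ and x > 0. Define F(y) := (1/Γ(k−μ)) ∫₀^y (y−t)^{k−μ−1} t^α L_n^{(α)}(t) dt for y > 0. Then the k-th iterated derivative of F at x equals (Γ(n+α+1)/Γ(n+α−μ+1)) · x^{α−μ} · L_n^{(α−μ)}(x); i.e. the left Riemann–Liouville fractional derivative of order μ of t ↦ t^α L_n^{(α)}(t) equals (Γ(n+α+1)/Γ(n+α−μ+1)) x^{α−μ} L_n^{(α−μ)}(x). -/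
/-- The Euler beta integral over `[0, y]`, with real exponents. -/
lemma integral_sub_rpow_mul_rpow {a b y : ℝ} (ha : 0 < a) (hb : 0 < b) (hy : 0 < y) :
    ∫ t in (0 : ℝ)..y, (y - t) ^ (b - 1) * t ^ (a - 1) =
      Real.Gamma a * Real.Gamma b / Real.Gamma (a + b) * y ^ (a + b - 1) := by
  have h := Complex.betaIntegral_scaled a b hy
  rw [Complex.betaIntegral_eq_Gamma_mul_div _ _ (by simpa) (by simpa)] at h
  have hint : ∫ t in (0 : ℝ)..y, (t : ℂ) ^ ((a : ℂ) - 1) * ((y : ℂ) - t) ^ ((b : ℂ) - 1) =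
      ∫ t in (0 : ℝ)..y, (((y - t) ^ (b - 1) * t ^ (a - 1) : ℝ) : ℂ) := by
    refine intervalIntegral.integral_congr fun t ht => ?_
    rw [Set.uIcc_of_le hy.le] at ht
    rw [Complex.ofReal_mul, Complex.ofReal_cpow (sub_nonneg.2 ht.2), Complex.ofReal_cpow ht.1]
    push_cast
    ring
  rw [hint, intervalIntegral.integral_ofReal, ← Complex.ofReal_add, Complex.Gamma_ofReal,
    Complex.Gamma_ofReal, Complex.Gamma_ofReal, ← Complex.ofReal_one, ← Complex.ofReal_sub,
    ← Complex.ofReal_cpow hy.le] at h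
  rw [mul_comm]
  exact_mod_cast h

lemma intervalIntegrable_sub_rpow_mul_rpow {a b y : ℝ} (ha : 0 < a) (hb : 0 < b) (hy : 0 < y) :
    IntervalIntegrable (fun t => (y - t) ^ (b - 1) * t ^ (a - 1)) MeasureTheory.volume 0 y := by
  by_contra h
  have h0 := integral_sub_rpow_mul_rpow ha hb hy
  rw [intervalIntegral.integral_undef h] at h0
  have hΓa := Real.Gamma_pos_of_pos ha
  have hΓb := Real.Gamma_pos_of_pos hb
  have hΓab := Real.Gamma_pos_of_pos (add_pos ha hb)
  have hpos : 0 < Real.Gamma a * Real.Gamma b / Real.Gamma (a + b) * y ^ (a + b - 1) := by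
    positivity
  exact hpos.ne h0

lemma iteratedDeriv_sum_rpow_div_Gamma {ι : Type*} (s : Finset ι) (c β : ι → ℝ)
    (hβ : ∀ j ∈ s, -1 < β j) (k : ℕ) {x : ℝ} (hx : 0 < x) :
    iteratedDeriv k (fun y => ∑ j ∈ s, c j * (y ^ (β j + k) / Real.Gamma (β j + k + 1))) x =
      ∑ j ∈ s, c j * (x ^ β j / Real.Gamma (β j + 1)) := by
  induction k with
  | zero => simp
  | succ k ih =>
    rw [iteratedDeriv_succ', ← ih]
    refine Filter.EventuallyEq.iteratedDeriv_eq k ?_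
    filter_upwards [lt_mem_nhds hx] with y hy
    refine (HasDerivAt.fun_sum fun j hj => ?_).deriv
    have hpos : 0 < β j + k + 1 := by
      have := hβ j hj
      have : (0 : ℝ) ≤ k := k.cast_nonneg
      linarith
    refine (((Real.hasDerivAt_rpow_const (p := β j + (k + 1 : ℕ)) (Or.inl hy.ne')).div_const
      (Real.Gamma (β j + (k + 1 : ℕ) + 1))).const_mul (c j)).congr_deriv ?_
    rw [Nat.cast_add_one, ← add_assoc, Real.Gamma_add_one hpos.ne', add_sub_cancel_right,
      mul_div_mul_left _ _ hpos.ne']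

/-- The fractional integral of order `b` of `t ↦ t ^ α * lagL α n t`. -/
lemma integral_sub_rpow_mul_lagL {α b y : ℝ} (hα : -1 < α) (hb : 0 < b) (hy : 0 < y) (n : ℕ) :
    1 / Real.Gamma b * ∫ t in (0 : ℝ)..y, (y - t) ^ (b - 1) * (t ^ α * lagL α n t) =
      ∑ j ∈ Finset.range (n + 1),
        (-1) ^ j * Real.Gamma (n + α + 1) / (Real.Gamma ((n - j : ℕ) + 1) * (j.factorial : ℝ)) *
          (y ^ (j + α + b) / Real.Gamma (j + α + b + 1)) := by
  have hpos (j : ℕ) : 0 < (j : ℝ) + α + 1 := by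
    have : (0 : ℝ) ≤ j := j.cast_nonneg
    linarith
  have hint : ∫ t in (0 : ℝ)..y, (y - t) ^ (b - 1) * (t ^ α * lagL α n t) =
      ∫ t in (0 : ℝ)..y, ∑ j ∈ Finset.range (n + 1),
        (-1) ^ j * (Real.Gamma (n + α + 1) /
          (Real.Gamma (j + α + 1) * Real.Gamma ((n - j : ℕ) + 1))) / (j.factorial : ℝ) *
          ((y - t) ^ (b - 1) * t ^ ((j : ℝ) + α + 1 - 1)) := by
    simp_rw [intervalIntegral.integral_of_le hy.le]
    refine MeasureTheory.setIntegral_congr_fun measurableSet_Ioc fun t ht => ?_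
    simp only [lagL, Finset.mul_sum]
    refine Finset.sum_congr rfl fun j _ => ?_
    rw [add_sub_cancel_right, Real.rpow_add ht.1, Real.rpow_natCast]
    ring
  rw [hint, intervalIntegral.integral_finsetSum fun j _ =>
    (intervalIntegrable_sub_rpow_mul_rpow (hpos j) hb hy).const_mul _, Finset.mul_sum]
  refine Finset.sum_congr rfl fun j _ => ?_
  rw [intervalIntegral.integral_const_mul, integral_sub_rpow_mul_rpow (hpos j) hb hy,
    show (j : ℝ) + α + 1 + b = j + α + b + 1 by ring, add_sub_cancel_right]
  have h1 := (Real.Gamma_pos_of_pos (hpos j)).ne'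
  have h2 := (Real.Gamma_pos_of_pos hb).ne'
  field_simp

/-- for k ≥ 1, μ ∈ [k−1,k), α > μ−1, n ∈ ℕ, x > 0, the left
Riemann–Liouville fractional derivative of order μ of t ↦ t^α L_n^{(α)}(t),
i.e. the k-th derivative at x of
F(y) = (1/Γ(k−μ)) ∫₀^y (y−t)^{k−μ−1} t^α L_n^{(α)}(t) dt,
equals (Γ(n+α+1)/Γ(n+α−μ+1)) x^{α−μ} L_n^{(α−μ)}(x). -/
theorem fracDeriv_lagL (k : ℕ) (hk : 1 ≤ k) (mu : ℝ) (hmu1 : (k : ℝ) - 1 ≤ mu)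
    (hmu2 : mu < k) (α : ℝ) (hα : mu - 1 < α) (n : ℕ) (x : ℝ) (hx : 0 < x) :
    iteratedDeriv k
        (fun y => (1 / Real.Gamma ((k : ℝ) - mu)) *
          ∫ t in (0 : ℝ)..y, (y - t) ^ ((k : ℝ) - mu - 1) * (t ^ α * lagL α n t)) x
      = (Real.Gamma ((n : ℝ) + α + 1) / Real.Gamma ((n : ℝ) + α - mu + 1)) *
          x ^ (α - mu) * lagL (α - mu) n x := by
  have hk1 : (1 : ℝ) ≤ k := by exact_mod_cast hk
  have hβ (j : ℕ) : -1 < (j : ℝ) + α - mu := by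
    have : (0 : ℝ) ≤ j := j.cast_nonneg
    linarith
  have hF : (fun y => (1 / Real.Gamma ((k : ℝ) - mu)) *
      ∫ t in (0 : ℝ)..y, (y - t) ^ ((k : ℝ) - mu - 1) * (t ^ α * lagL α n t)) =ᶠ[nhds x]
      fun y => ∑ j ∈ Finset.range (n + 1),
        (-1) ^ j * Real.Gamma (n + α + 1) / (Real.Gamma ((n - j : ℕ) + 1) * (j.factorial : ℝ)) *
          (y ^ (j + α - mu + k) / Real.Gamma (j + α - mu + k + 1)) := by
    filter_upwards [lt_mem_nhds hx] with y hy
    rw [integral_sub_rpow_mul_lagL (by linarith) (sub_pos.2 hmu2) hy]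
    refine Finset.sum_congr rfl fun j _ => ?_
    rw [show (j : ℝ) + α + (k - mu) = j + α - mu + k by ring]
  rw [hF.iteratedDeriv_eq,
    iteratedDeriv_sum_rpow_div_Gamma _ _ (fun j : ℕ => (j : ℝ) + α - mu) (fun j _ => hβ j) k hx,
    lagL, Finset.mul_sum]
  refine Finset.sum_congr rfl fun j _ => ?_
  have hΓ : Real.Gamma (n + α - mu + 1) ≠ 0 :=
    (Real.Gamma_pos_of_pos (by linarith [hβ n])).ne'
  simp only [add_sub_assoc] at hΓ ⊢
  rw [Real.rpow_add hx, Real.rpow_natCast]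
  field_simp
end

section
/- Let μ > 0, α > μ−1, n ∈ ℕ and x ≥ 0. Then (1/Γ(μ)) ∫_x^∞ (y−x)^{μ−1} e^{−y} L_n^{(α)}(y) dy = e^{−x} · L_n^{(α−μ)}(x). -/
open Finset in
/-- The Chu-Vandermonde identity, in terms of the Gamma function. -/
lemma sum_neg_one_pow_choose_mul_Gamma_div (m : ℕ) {b a : ℝ} (hb : 0 < b) (hab : b < a) :
    ∑ i ∈ range (m + 1), (m.choose i : ℝ) * ((-1) ^ i * Real.Gamma (b + i) / Real.Gamma (a + i))
      = Real.Gamma b * Real.Gamma (a - b + m) / (Real.Gamma (a - b) * Real.Gamma (a + m)) := by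
  induction m generalizing a b with
  | zero =>
    have : Real.Gamma (a - b) ≠ 0 := (Real.Gamma_pos_of_pos (by linarith)).ne'
    simp only [zero_add, range_one, sum_singleton, Nat.choose_self, Nat.cast_one, pow_zero,
      Nat.cast_zero, add_zero, one_mul]
    field_simp
  | succ m ih =>
    have hstep := sum_choose_succ_mul
      (fun i _ => (-1 : ℝ) ^ i * Real.Gamma (b + i) / Real.Gamma (a + i)) m
    have hshift : ∑ i ∈ range (m + 1), (m.choose i : ℝ) *
          ((-1) ^ (i + 1) * Real.Gamma (b + (i + 1 : ℕ)) / Real.Gamma (a + (i + 1 : ℕ)))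
        = -∑ i ∈ range (m + 1), (m.choose i : ℝ) *
          ((-1) ^ i * Real.Gamma (b + 1 + i) / Real.Gamma (a + 1 + i)) := by
      rw [← sum_neg_distrib]
      refine sum_congr rfl fun i _ => ?_
      push_cast
      rw [show b + ((i : ℝ) + 1) = b + 1 + i by ring, show a + ((i : ℝ) + 1) = a + 1 + i by ring]
      ring
    rw [hstep, hshift, ih hb hab, ih (by linarith : 0 < b + 1) (by linarith : b + 1 < a + 1)]
    have hm : (0 : ℝ) ≤ m := m.cast_nonneg
    have hΓab : Real.Gamma (a - b) ≠ 0 := (Real.Gamma_pos_of_pos (by linarith)).ne'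
    have hΓam : Real.Gamma (a + m) ≠ 0 := (Real.Gamma_pos_of_pos (by linarith)).ne'
    have ham : a + m ≠ 0 := by linarith
    push_cast
    rw [show a + 1 - (b + 1) = a - b by ring, show a + 1 + (m : ℝ) = a + m + 1 by ring,
      show a + ((m : ℝ) + 1) = a + m + 1 by ring, show a - b + ((m : ℝ) + 1) = a - b + m + 1 by ring,
      Real.Gamma_add_one hb.ne', Real.Gamma_add_one ham,
      Real.Gamma_add_one (by linarith : a - b + m ≠ 0)]
    field_simp
    ring

open MeasureTheory Set in
lemma integral_rpow_mul_exp_neg_mul_sum {ι : Type*} (s : Finset ι) (c : ι → ℝ) (d : ι → ℕ)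
    {b : ℝ} (hb : 0 < b) :
    ∫ t in Ioi (0 : ℝ), t ^ (b - 1) * (Real.exp (-t) * ∑ i ∈ s, c i * t ^ d i)
      = ∑ i ∈ s, c i * Real.Gamma (b + d i) := by
  have hpos (i : ι) : 0 < b + d i := by positivity
  have hexpand : ∀ t ∈ Ioi (0 : ℝ), t ^ (b - 1) * (Real.exp (-t) * ∑ i ∈ s, c i * t ^ d i)
      = ∑ i ∈ s, c i * (Real.exp (-t) * t ^ (b + d i - 1)) := by
    intro t ht
    simp only [Finset.mul_sum]
    refine Finset.sum_congr rfl fun i _ => ?_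
    rw [show b + d i - 1 = b - 1 + d i by ring, Real.rpow_add_natCast (ne_of_gt ht)]
    ring
  rw [setIntegral_congr_fun measurableSet_Ioi hexpand,
    integral_finsetSum _ fun i _ => (Real.GammaIntegral_convergent (hpos i)).const_mul _]
  refine Finset.sum_congr rfl fun i _ => ?_
  rw [integral_const_mul, ← Real.Gamma_eq_integral (hpos i)]

open Finset in
/-- Taylor expansion of `lagL α n` at `x`. -/
lemma lagL_add (α : ℝ) (n : ℕ) (x t : ℝ) :
    lagL α n (x + t) = ∑ p ∈ (range (n + 1)).sigma fun k => range (n + 1 - k),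
      (-1 : ℝ) ^ (p.1 + p.2) * (Real.Gamma (n + α + 1) /
        (Real.Gamma (p.1 + p.2 + α + 1) * (n - p.1 - p.2).factorial)) *
        (x ^ p.1 / (p.1.factorial * p.2.factorial)) * t ^ p.2 := by
  rw [sum_sigma, ← sum_range_diag_flip (n + 1) fun k i => (-1 : ℝ) ^ (k + i) *
    (Real.Gamma (n + α + 1) / (Real.Gamma (k + i + α + 1) * (n - k - i).factorial)) *
    (x ^ k / (k.factorial * i.factorial)) * t ^ i, lagL]
  refine sum_congr rfl fun j _ => ?_
  rw [add_pow, mul_sum, sum_div]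
  refine sum_congr rfl fun k hk => ?_
  obtain ⟨i, rfl⟩ := Nat.exists_eq_add_of_le (mem_range_succ_iff.mp hk)
  rw [Nat.cast_add_choose, Real.Gamma_nat_eq_factorial, Nat.add_sub_cancel_left, Nat.sub_sub]
  push_cast
  have := (k + i).factorial_ne_zero
  field_simp

/-- for μ > 0, α > μ−1, n ∈ ℕ, x ≥ 0:
(1/Γ(μ)) ∫_x^∞ (y−x)^{μ−1} e^{−y} L_n^{(α)}(y) dy = e^{−x} L_n^{(α−μ)}(x). -/
theorem rightFracInt_exp_lagL (mu α : ℝ) (hmu : 0 < mu) (hα : mu - 1 < α)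
    (n : ℕ) (x : ℝ) (hx : 0 ≤ x) :
    (1 / Real.Gamma mu) *
        ∫ y in Set.Ioi x, (y - x) ^ (mu - 1) * (Real.exp (-y) * lagL α n y)
      = Real.exp (-x) * lagL (α - mu) n x := by
  have hshift := (MeasureTheory.measurePreserving_add_left MeasureTheory.volume x).setIntegral_preimage_emb
    (measurableEmbedding_addLeft x)
    (fun y => (y - x) ^ (mu - 1) * (Real.exp (-y) * lagL α n y)) (Set.Ioi x)
  have hpre : (x + ·) ⁻¹' Set.Ioi x = Set.Ioi 0 := by ext; simp
  have hint : ∀ t : ℝ, (x + t - x) ^ (mu - 1) * (Real.exp (-(x + t)) * lagL α n (x + t))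
      = Real.exp (-x) * (t ^ (mu - 1) * (Real.exp (-t) * lagL α n (x + t))) := by
    intro t
    rw [add_sub_cancel_left, neg_add, Real.exp_add]
    ring
  rw [← hshift, hpre]
  simp only [hint]
  simp only [lagL_add]
  rw [MeasureTheory.integral_const_mul, integral_rpow_mul_exp_neg_mul_sum _ _ _ hmu, mul_left_comm,
    Finset.sum_sigma, lagL, Finset.mul_sum]
  congr 1
  refine Finset.sum_congr rfl fun k hk => ?_
  obtain ⟨m, rfl⟩ := Nat.exists_eq_add_of_le (Finset.mem_range_succ_iff.mp hk)
  have hk0 : (0 : ℝ) ≤ k := k.cast_nonneg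
  have hm0 : (0 : ℝ) ≤ m := m.cast_nonneg
  have hcv := sum_neg_one_pow_choose_mul_Gamma_div m hmu (by linarith : mu < k + α + 1)
  have hΓmu : Real.Gamma mu ≠ 0 := (Real.Gamma_pos_of_pos hmu).ne'
  have hΓ : Real.Gamma (k + α + 1 + m) ≠ 0 := (Real.Gamma_pos_of_pos (by linarith)).ne'
  have hsum : ∑ i ∈ Finset.range (k + m + 1 - k), (-1 : ℝ) ^ (k + i) *
        (Real.Gamma ((k + m : ℕ) + α + 1) /
          (Real.Gamma (k + i + α + 1) * (k + m - k - i).factorial)) *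
        (x ^ k / (k.factorial * i.factorial)) * Real.Gamma (mu + i)
      = (-1) ^ k * Real.Gamma (k + α + 1 + m) * x ^ k / (k.factorial * m.factorial) *
        ∑ i ∈ Finset.range (m + 1), (m.choose i : ℝ) *
          ((-1) ^ i * Real.Gamma (mu + i) / Real.Gamma (k + α + 1 + i)) := by
    rw [Finset.mul_sum, add_assoc, Nat.add_sub_cancel_left]
    refine Finset.sum_congr rfl fun i hi => ?_
    rw [Nat.cast_choose ℝ (Finset.mem_range_succ_iff.mp hi), Nat.add_sub_cancel_left,
      show (k : ℝ) + i + α + 1 = k + α + 1 + i by ring]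
    push_cast
    rw [show (k : ℝ) + m + α + 1 = k + α + 1 + m by ring]
    field_simp
    ring
  rw [hsum, hcv, Nat.add_sub_cancel_left, Real.Gamma_nat_eq_factorial]
  push_cast
  rw [show (k : ℝ) + m + (α - mu) + 1 = k + α + 1 - mu + m by ring,
    show (k : ℝ) + (α - mu) + 1 = k + α + 1 - mu by ring]
  field_simp
end

section
/- Let k ∈ ℕ with k ≥ 1, μ ∈ [k−1, k), α > −1, n ∈ ℕ and x ≥ 0. Define G(y) := (1/Γ(k−μ)) ∫_y^∞ (t−y)^{k−μ−1} e^{−t} L_n^{(α)}(t) dt. Then (−1)^k times the k-th iterated derivative of G at x equals e^{−x} · L_n^{(α+μ)}(x); i.e. the right Riemann–Liouville fractional derivative of order μ of t ↦ e^{−t} L_n^{(α)}(t) equals e^{−x} L_n^{(α+μ)}(x). -/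
section

open Finset MeasureTheory

/-- The coefficient of `X ^ n` in `exp (-x X) * (1 + X) ^ b`, which is the Laguerre polynomial
`L_n^{(b - n)}(x)`, defined for every real parameter `b`. -/
noncomputable def laguerreCoeff (b : ℝ) (n : ℕ) (x : ℝ) : ℝ :=
  ∑ p ∈ antidiagonal n, (-x) ^ p.1 / (p.1.factorial : ℝ) * Ring.choose b p.2

lemma laguerreCoeff_eq_coeff (b : ℝ) (n : ℕ) (x : ℝ) :
    laguerreCoeff b n x = PowerSeries.coeff n
      (PowerSeries.rescale (-x) (PowerSeries.exp ℝ) * PowerSeries.binomialSeries ℝ b) := by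
  simp [laguerreCoeff, PowerSeries.coeff_mul, PowerSeries.coeff_rescale, PowerSeries.coeff_exp,
    PowerSeries.binomialSeries_coeff, div_eq_mul_inv]

lemma laguerreCoeff_add (b : ℝ) (n : ℕ) (x y : ℝ) :
    laguerreCoeff b n (x + y) =
      ∑ p ∈ antidiagonal n, (-y) ^ p.1 / (p.1.factorial : ℝ) * laguerreCoeff b p.2 x := by
  rw [laguerreCoeff_eq_coeff, neg_add_rev, ← PowerSeries.exp_mul_exp_eq_exp_add, mul_assoc,
    PowerSeries.coeff_mul]
  simp [laguerreCoeff_eq_coeff, PowerSeries.coeff_rescale, PowerSeries.coeff_exp, div_eq_mul_inv]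

lemma Ring.choose_succ_mul (r : ℝ) (m : ℕ) :
    ((m : ℝ) + 1) * Ring.choose r (m + 1) = (r - m) * Ring.choose r m := by
  have h := Ring.descPochhammer_eq_factorial_smul_choose r (m + 1)
  rw [descPochhammer_succ_right, Polynomial.smeval_mul,
    Ring.descPochhammer_eq_factorial_smul_choose] at h
  simp only [Polynomial.smeval_sub, Polynomial.smeval_X, Polynomial.smeval_natCast, pow_one,
    pow_zero, nsmul_eq_mul, mul_one, Nat.factorial_succ, Nat.cast_mul, Nat.cast_add,
    Nat.cast_one] at h
  have hm : (m.factorial : ℝ) ≠ 0 := by positivity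
  apply mul_left_cancel₀ hm
  linear_combination -h

lemma Gamma_add_one_eq_factorial_mul_choose (r : ℝ) (m : ℕ) (h : 0 < r - m + 1) :
    Real.Gamma (r + 1) = m.factorial * Ring.choose r m * Real.Gamma (r - m + 1) := by
  induction m with
  | zero => simp
  | succ m ih =>
    push_cast at h
    have hg := Real.Gamma_add_one (s := r - m) (by linarith)
    rw [ih (by linarith), hg, Nat.factorial_succ]
    push_cast
    rw [show r - (m + 1) + 1 = r - m by ring]
    linear_combination -(m.factorial : ℝ) * Real.Gamma (r - m) * Ring.choose_succ_mul r m

lemma Gamma_add_natCast (s : ℝ) (hs : 0 < s) (j : ℕ) :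
    Real.Gamma (s + j) = (-1) ^ j * j.factorial * Ring.choose (-s) j * Real.Gamma s := by
  induction j with
  | zero => simp
  | succ j ih =>
    have hg := Real.Gamma_add_one (s := s + j) (by positivity)
    rw [Nat.factorial_succ]
    push_cast
    rw [← add_assoc, hg, ih, pow_succ]
    linear_combination
      (-1 : ℝ) ^ j * (j.factorial : ℝ) * Real.Gamma s * Ring.choose_succ_mul (-s) j

lemma lagL_eq_laguerreCoeff (α : ℝ) (hα : -1 < α) (n : ℕ) (x : ℝ) :
    lagL α n x = laguerreCoeff (n + α) n x := by
  rw [lagL, laguerreCoeff, Finset.Nat.sum_antidiagonal_eq_sum_range_succ_mk]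
  refine Finset.sum_congr rfl fun j hj => ?_
  have hj' : j ≤ n := Nat.lt_succ_iff.mp (Finset.mem_range.mp hj)
  have hcast : (n : ℝ) + α - ((n - j : ℕ) : ℝ) + 1 = j + α + 1 := by
    rw [Nat.cast_sub hj']; ring
  have hpos : 0 < (j : ℝ) + α + 1 := by
    have : (0 : ℝ) ≤ j := j.cast_nonneg
    linarith
  rw [Gamma_add_one_eq_factorial_mul_choose (n + α) (n - j) (by rwa [hcast]), hcast,
    Real.Gamma_nat_eq_factorial, neg_pow x]
  have := (Real.Gamma_pos_of_pos hpos).ne'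
  have : ((n - j).factorial : ℝ) ≠ 0 := by positivity
  field_simp

lemma hasDerivAt_laguerreCoeff_succ (b : ℝ) (n : ℕ) (x : ℝ) :
    HasDerivAt (laguerreCoeff b (n + 1)) (-laguerreCoeff b n x) x := by
  have hfun : laguerreCoeff b (n + 1) = fun x => Ring.choose b (n + 1) +
      ∑ p ∈ antidiagonal n,
        (-x) ^ (p.1 + 1) / ((p.1 + 1).factorial : ℝ) * Ring.choose b p.2 := by
    ext x
    simp [laguerreCoeff, Finset.Nat.sum_antidiagonal_succ]
  rw [hfun, laguerreCoeff, ← Finset.sum_neg_distrib]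
  refine (HasDerivAt.fun_sum fun p _ => ?_).const_add _
  have h := (((hasDerivAt_id x).neg.pow (p.1 + 1)).div_const
    ((p.1 + 1).factorial : ℝ)).mul_const (Ring.choose b p.2)
  convert! h using 1
  rw [Nat.factorial_succ]
  push_cast
  simp
  field_simp

lemma laguerreCoeff_zero (b x : ℝ) : laguerreCoeff b 0 x = 1 := by
  simp [laguerreCoeff]

lemma laguerreCoeff_add_one_succ (b : ℝ) (n : ℕ) (x : ℝ) :
    laguerreCoeff (b + 1) (n + 1) x = laguerreCoeff b (n + 1) x + laguerreCoeff b n x := by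
  simp only [laguerreCoeff, Finset.Nat.sum_antidiagonal_succ', Ring.choose_succ_succ,
    Ring.choose_zero_right, mul_add, Finset.sum_add_distrib]
  ring

lemma hasDerivAt_exp_neg_mul_laguerreCoeff (b : ℝ) (n : ℕ) (x : ℝ) :
    HasDerivAt (fun y => Real.exp (-y) * laguerreCoeff b n y)
      (-(Real.exp (-x) * laguerreCoeff (b + 1) n x)) x := by
  have he : HasDerivAt (fun y : ℝ => Real.exp (-y)) (-Real.exp (-x)) x := by
    simpa using (hasDerivAt_neg x).exp
  cases n with
  | zero => simpa [laguerreCoeff_zero] using he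
  | succ n =>
    convert! he.mul (hasDerivAt_laguerreCoeff_succ b n x) using 1
    rw [laguerreCoeff_add_one_succ]
    ring

lemma iteratedDeriv_exp_neg_mul_laguerreCoeff (b : ℝ) (n k : ℕ) :
    iteratedDeriv k (fun y => Real.exp (-y) * laguerreCoeff b n y) =
      fun x => (-1) ^ k * (Real.exp (-x) * laguerreCoeff (b + k) n x) := by
  induction k with
  | zero => simp
  | succ k ih =>
    ext x
    rw [iteratedDeriv_succ, ih,
      ((hasDerivAt_exp_neg_mul_laguerreCoeff (b + k) n x).const_mul _).deriv]
    push_cast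
    rw [← add_assoc]
    ring

lemma integrableOn_rpow_mul_exp_neg_mul_pow {s : ℝ} (hs : 0 < s) (j : ℕ) :
    IntegrableOn (fun u : ℝ => u ^ (s - 1) * (Real.exp (-u) * u ^ j)) (Set.Ioi 0) := by
  refine (Real.GammaIntegral_convergent (s := s + j) (by positivity)).congr_fun
    (fun u hu => ?_) measurableSet_Ioi
  dsimp only
  rw [show s + j - 1 = s - 1 + j by ring, Real.rpow_add hu, Real.rpow_natCast]
  ring

lemma integral_rpow_mul_exp_neg_mul_pow {s : ℝ} (hs : 0 < s) (j : ℕ) :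
    ∫ u in Set.Ioi (0 : ℝ), u ^ (s - 1) * (Real.exp (-u) * u ^ j) = Real.Gamma (s + j) := by
  rw [Real.Gamma_eq_integral (by positivity)]
  refine setIntegral_congr_fun measurableSet_Ioi fun u hu => ?_
  rw [show s + j - 1 = s - 1 + j by ring, Real.rpow_add hu, Real.rpow_natCast]
  ring

lemma rpow_mul_exp_neg_mul_laguerreCoeff (s b : ℝ) (n : ℕ) (u : ℝ) :
    u ^ (s - 1) * (Real.exp (-u) * laguerreCoeff b n u) =
      ∑ p ∈ antidiagonal n, (-1) ^ p.1 / (p.1.factorial : ℝ) * Ring.choose b p.2 *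
        (u ^ (s - 1) * (Real.exp (-u) * u ^ p.1)) := by
  rw [laguerreCoeff, Finset.mul_sum, Finset.mul_sum]
  refine Finset.sum_congr rfl fun p _ => ?_
  rw [neg_pow u]
  ring

lemma integrableOn_rpow_mul_exp_neg_mul_laguerreCoeff {s : ℝ} (hs : 0 < s) (b : ℝ) (n : ℕ) :
    IntegrableOn (fun u : ℝ => u ^ (s - 1) * (Real.exp (-u) * laguerreCoeff b n u))
      (Set.Ioi 0) := by
  simp only [rpow_mul_exp_neg_mul_laguerreCoeff]
  exact integrable_finsetSum _ fun p _ =>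
    (integrableOn_rpow_mul_exp_neg_mul_pow hs p.1).const_mul _

lemma integral_rpow_mul_exp_neg_mul_laguerreCoeff {s : ℝ} (hs : 0 < s) (b : ℝ) (n : ℕ) :
    ∫ u in Set.Ioi (0 : ℝ), u ^ (s - 1) * (Real.exp (-u) * laguerreCoeff b n u) =
      Real.Gamma s * Ring.choose (b - s) n := by
  simp only [rpow_mul_exp_neg_mul_laguerreCoeff]
  rw [integral_finsetSum _ fun p _ =>
      (integrableOn_rpow_mul_exp_neg_mul_pow hs p.1).const_mul _,
    show b - s = -s + b by ring, Ring.add_choose_eq n (Commute.all _ _), Finset.mul_sum]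
  refine Finset.sum_congr rfl fun p _ => ?_
  rw [integral_const_mul, integral_rpow_mul_exp_neg_mul_pow hs, Gamma_add_natCast s hs]
  have hsq : ((-1 : ℝ) ^ p.1) ^ 2 = 1 := by rw [← pow_mul, mul_comm, pow_mul]; simp
  field_simp
  rw [hsq, one_mul]

/-- The right Riemann–Liouville fractional integral lowers the parameter by its order. -/
lemma integral_Ioi_sub_rpow_mul_exp_neg_mul_laguerreCoeff {s : ℝ} (hs : 0 < s) (b : ℝ) (n : ℕ)
    (y : ℝ) :
    ∫ t in Set.Ioi y, (t - y) ^ (s - 1) * (Real.exp (-t) * laguerreCoeff b n t) =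
      Real.Gamma s * (Real.exp (-y) * laguerreCoeff (b - s) n y) := by
  have hshift := (measurePreserving_add_right volume y).setIntegral_preimage_emb
    (measurableEmbedding_addRight y)
    (fun t => (t - y) ^ (s - 1) * (Real.exp (-t) * laguerreCoeff b n t)) (Set.Ioi y)
  have hexpand : ∀ u : ℝ,
      (u + y - y) ^ (s - 1) * (Real.exp (-(u + y)) * laguerreCoeff b n (u + y)) =
        ∑ p ∈ antidiagonal n, Real.exp (-y) * ((-y) ^ p.1 / (p.1.factorial : ℝ)) *
          (u ^ (s - 1) * (Real.exp (-u) * laguerreCoeff b p.2 u)) := by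
    intro u
    rw [laguerreCoeff_add, add_sub_cancel_right, neg_add, Real.exp_add, Finset.mul_sum,
      Finset.mul_sum]
    refine Finset.sum_congr rfl fun p _ => ?_
    ring
  rw [← hshift]
  simp only [Set.preimage_add_const_Ioi, sub_self, hexpand]
  rw [integral_finsetSum _ fun p _ =>
      (integrableOn_rpow_mul_exp_neg_mul_laguerreCoeff hs b p.2).const_mul _,
    laguerreCoeff, Finset.mul_sum, Finset.mul_sum]
  refine Finset.sum_congr rfl fun p _ => ?_
  rw [integral_const_mul, integral_rpow_mul_exp_neg_mul_laguerreCoeff hs]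
  ring

end

/-- for k ≥ 1, μ ∈ [k−1,k), α > −1, n ∈ ℕ, x ≥ 0, the right
Riemann–Liouville fractional derivative of order μ of t ↦ e^{−t} L_n^{(α)}(t),
i.e. (−1)^k times the k-th derivative at x of
G(y) = (1/Γ(k−μ)) ∫_y^∞ (t−y)^{k−μ−1} e^{−t} L_n^{(α)}(t) dt,
equals e^{−x} L_n^{(α+μ)}(x). -/
theorem rightFracDeriv_exp_lagL (k : ℕ) (hk : 1 ≤ k) (mu : ℝ) (hmu1 : (k : ℝ) - 1 ≤ mu)
    (hmu2 : mu < k) (α : ℝ) (hα : -1 < α) (n : ℕ) (x : ℝ) (hx : 0 ≤ x) :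
    (-1 : ℝ) ^ k *
        iteratedDeriv k
          (fun y => (1 / Real.Gamma ((k : ℝ) - mu)) *
            ∫ t in Set.Ioi y, (t - y) ^ ((k : ℝ) - mu - 1) * (Real.exp (-t) * lagL α n t)) x
      = Real.exp (-x) * lagL (α + mu) n x := by
  have hs : 0 < (k : ℝ) - mu := sub_pos.mpr hmu2
  have hmu : 0 ≤ mu := by
    have : (1 : ℝ) ≤ k := by exact_mod_cast hk
    linarith
  have hG : (fun y => (1 / Real.Gamma ((k : ℝ) - mu)) *
      ∫ t in Set.Ioi y, (t - y) ^ ((k : ℝ) - mu - 1) * (Real.exp (-t) * lagL α n t)) =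
      fun y => Real.exp (-y) * laguerreCoeff (n + α - (k - mu)) n y := by
    ext y
    simp only [lagL_eq_laguerreCoeff α hα]
    rw [integral_Ioi_sub_rpow_mul_exp_neg_mul_laguerreCoeff hs, one_div,
      inv_mul_cancel_left₀ (Real.Gamma_pos_of_pos hs).ne']
  rw [hG, iteratedDeriv_exp_neg_mul_laguerreCoeff, lagL_eq_laguerreCoeff _ (by linarith),
    ← mul_assoc, ← mul_pow, show (n : ℝ) + α - (k - mu) + k = n + (α + mu) by ring]
  norm_num
end

section
/- Let k ∈ ℕ, α > k−1, n ∈ ℕ and x > 0. Then the k-th iterated derivative of the function y ↦ y^α e^{−y} L_n^{(α)}(y), evaluated at x, equals (Γ(n+k+1)/Γ(n+1)) · x^{α−k} · e^{−x} · L_{n+k}^{(α−k)}(x). -/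
/-- The coefficient of `x ^ j` in `L_n^{(α)}`. -/
noncomputable def lagCoeff (α : ℝ) (n j : ℕ) : ℝ :=
  (-1 : ℝ) ^ j *
    (Real.Gamma ((n : ℝ) + α + 1) /
      (Real.Gamma ((j : ℝ) + α + 1) * Real.Gamma (((n - j : ℕ) : ℝ) + 1))) / (Nat.factorial j : ℝ)

theorem lagL_eq_sum_lagCoeff (α : ℝ) (n : ℕ) (x : ℝ) :
    lagL α n x = ∑ j ∈ Finset.range (n + 1), lagCoeff α n j * x ^ j :=
  Finset.sum_congr rfl fun _ _ => by rw [lagCoeff]; ring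

theorem lagCoeff_sub_one_succ {α : ℝ} (hα : 0 < α) {n j : ℕ} (hj : j ≤ n) :
    ((n : ℝ) + 1 - j) * lagCoeff (α - 1) (n + 1) j = (j + α) * lagCoeff α n j := by
  obtain ⟨m, rfl⟩ := Nat.exists_eq_add_of_le hj
  have hjα : 0 < (j : ℝ) + α := by positivity
  have hΓ := (Real.Gamma_pos_of_pos hjα).ne'
  have hn : ((j + m + 1 : ℕ) : ℝ) + (α - 1) + 1 = ((j + m : ℕ) : ℝ) + α + 1 := by
    push_cast; ring
  have hm : j + m + 1 - j = m + 1 := by omega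
  rw [lagCoeff, lagCoeff, hn, hm, Nat.add_sub_cancel_left, Real.Gamma_nat_eq_factorial,
    Real.Gamma_nat_eq_factorial, Real.Gamma_add_one hjα.ne',
    show (j : ℝ) + (α - 1) + 1 = j + α by ring, Nat.factorial_succ]
  push_cast
  field_simp
  ring

theorem lagCoeff_sub_one_succ_succ (α : ℝ) (n j : ℕ) :
    ((j : ℝ) + 1) * lagCoeff (α - 1) (n + 1) (j + 1) = -lagCoeff α n j := by
  have hn : ((n + 1 : ℕ) : ℝ) + (α - 1) + 1 = n + α + 1 := by push_cast; ring
  have hj : ((j + 1 : ℕ) : ℝ) + (α - 1) + 1 = j + α + 1 := by push_cast; ring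
  rw [lagCoeff, lagCoeff, hn, hj, Nat.add_sub_add_right, Nat.factorial_succ]
  push_cast
  field_simp
  ring

theorem succ_mul_lagL_sub_one {α : ℝ} (hα : 0 < α) (n : ℕ) (x : ℝ) :
    ((n : ℝ) + 1) * lagL (α - 1) (n + 1) x =
      ∑ j ∈ Finset.range (n + 1), (j + α) * lagCoeff α n j * x ^ j - x * lagL α n x := by
  have hsplit : ((n : ℝ) + 1) * lagL (α - 1) (n + 1) x =
      ∑ j ∈ Finset.range (n + 1 + 1), ((n : ℝ) + 1 - j) * lagCoeff (α - 1) (n + 1) j * x ^ j +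
        ∑ j ∈ Finset.range (n + 1 + 1), (j : ℝ) * lagCoeff (α - 1) (n + 1) j * x ^ j := by
    rw [lagL_eq_sum_lagCoeff, Finset.mul_sum, ← Finset.sum_add_distrib]
    exact Finset.sum_congr rfl fun _ _ => by ring
  rw [hsplit, Finset.sum_range_succ, Finset.sum_range_succ' (fun j : ℕ => (j : ℝ) * _ * _),
    lagL_eq_sum_lagCoeff, Finset.mul_sum,
    sub_eq_add_neg (∑ j ∈ _, _), ← Finset.sum_neg_distrib]
  push_cast
  simp only [sub_self, zero_mul, add_zero]
  congr 1
  · refine Finset.sum_congr rfl fun j hj => ?_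
    rw [lagCoeff_sub_one_succ hα (Finset.mem_range_succ_iff.mp hj)]
  · refine Finset.sum_congr rfl fun j _ => ?_
    rw [lagCoeff_sub_one_succ_succ]
    ring

theorem hasDerivAt_rpow_mul_exp_neg_mul_lagL {α : ℝ} (hα : 0 < α) (n : ℕ) {x : ℝ} (hx : 0 < x) :
    HasDerivAt (fun y => y ^ α * Real.exp (-y) * lagL α n y)
      (((n : ℝ) + 1) * (x ^ (α - 1) * Real.exp (-x) * lagL (α - 1) (n + 1) x)) x := by
  have hL : HasDerivAt (lagL α n)
      (∑ j ∈ Finset.range (n + 1), lagCoeff α n j * (j * x ^ (j - 1))) x := by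
    rw [funext (lagL_eq_sum_lagCoeff α n)]
    exact HasDerivAt.fun_sum fun j _ => (hasDerivAt_pow j x).const_mul _
  have hxL : x * ∑ j ∈ Finset.range (n + 1), lagCoeff α n j * (j * x ^ (j - 1)) =
      ∑ j ∈ Finset.range (n + 1), (j + α) * lagCoeff α n j * x ^ j - α * lagL α n x := by
    rw [lagL_eq_sum_lagCoeff, Finset.mul_sum, Finset.mul_sum, ← Finset.sum_sub_distrib]
    refine Finset.sum_congr rfl fun j _ => ?_
    rcases j with _ | j
    · simp
    · rw [Nat.add_sub_cancel, pow_succ]; ring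
  have hpow : x ^ α = x ^ (α - 1) * x := by
    rw [← Real.rpow_add_one hx.ne', sub_add_cancel]
  refine (((Real.hasDerivAt_rpow_const (p := α) (Or.inl hx.ne')).fun_mul
    (hasDerivAt_neg x).exp).fun_mul hL).congr_deriv ?_
  rw [hpow]
  linear_combination x ^ (α - 1) * Real.exp (-x) * (hxL - succ_mul_lagL_sub_one hα n x)

/-- for k ∈ ℕ, α > k−1, n ∈ ℕ, x > 0:
(d/dx)^k { x^α e^{−x} L_n^{(α)}(x) } = (Γ(n+k+1)/Γ(n+1)) x^{α−k} e^{−x} L_{n+k}^{(α−k)}(x). -/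
theorem iteratedDeriv_pow_exp_lagL (k : ℕ) (α : ℝ) (hα : (k : ℝ) - 1 < α)
    (n : ℕ) (x : ℝ) (hx : 0 < x) :
    iteratedDeriv k (fun y => y ^ α * Real.exp (-y) * lagL α n y) x
      = (Real.Gamma ((n : ℝ) + k + 1) / Real.Gamma ((n : ℝ) + 1)) *
          x ^ (α - k) * Real.exp (-x) * lagL (α - k) (n + k) x := by
  induction k generalizing x with
  | zero => simp [(Real.Gamma_pos_of_pos (by positivity : (0 : ℝ) < n + 1)).ne']
  | succ k ih =>
    push_cast at hα
    have hev : iteratedDeriv k (fun y => y ^ α * Real.exp (-y) * lagL α n y) =ᶠ[nhds x]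
        fun y => Real.Gamma ((n : ℝ) + k + 1) / Real.Gamma ((n : ℝ) + 1) *
          (y ^ (α - k) * Real.exp (-y) * lagL (α - k) (n + k) y) := by
      filter_upwards [lt_mem_nhds hx] with y hy
      rw [ih (by linarith) y hy]
      ring
    have hder := (hasDerivAt_rpow_mul_exp_neg_mul_lagL (α := α - k) (by linarith) (n + k)
      hx).const_mul (Real.Gamma ((n : ℝ) + k + 1) / Real.Gamma ((n : ℝ) + 1))
    have hnk : (n : ℝ) + k + 1 ≠ 0 := by positivity
    rw [iteratedDeriv_succ, hev.deriv_eq, hder.deriv]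
    push_cast
    rw [← add_assoc (n : ℝ), Real.Gamma_add_one hnk, ← sub_sub, ← add_assoc n]
    ring
end

section
/- Let λ > 0, k ∈ ℕ with k ≥ 1, μ ∈ [k−1, k), ν ≥ 0, n ∈ ℕ and x ≥ 0. Then the right tempered fractional derivative of order μ of the generalized Laguerre function 𝓛_n^{(ν,λ)} satisfies e^{λx} · (−1)^k · (the k-th iterated derivative at x of y ↦ (1/Γ(k−μ)) ∫_y^∞ (t−y)^{k−μ−1} e^{−2λt} L_n^{(ν)}(2λt) dt) = (2λ)^μ · e^{−λx} L_n^{(ν+μ)}(2λx). -/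
/-- Real binomial coefficients express ratios of Gamma values. -/
theorem Gamma_add_nat_eq_multichoose {s : ℝ} (hs : 0 < s) (q : ℕ) :
    Real.Gamma (s + q) = Real.Gamma s * (q.factorial * Ring.multichoose s q) := by
  have h := Ring.factorial_nsmul_multichoose_eq_ascPochhammer s q
  rw [nsmul_eq_mul, Polynomial.ascPochhammer_smeval_eq_eval] at h
  rw [h]
  clear h
  induction q with
  | zero => simp
  | succ q ih =>
    have h0 : s + q ≠ 0 := by positivity
    rw [Nat.cast_succ, ← add_assoc, Real.Gamma_add_one h0, ih, ascPochhammer_succ_eval]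
    ring

theorem choose_neg_real (s : ℝ) (q : ℕ) :
    Ring.choose (-s) q = (-1) ^ q * Ring.multichoose s q := by
  rw [Ring.choose_neg']
  simp [Int.negOnePow, Units.smul_def]

/-- The generalized Laguerre polynomial with coefficients written as real binomial coefficients,
which makes sense for every real parameter. -/
noncomputable def laguerreSum (α : ℝ) (n : ℕ) (x : ℝ) : ℝ :=
  ∑ p ∈ Finset.HasAntidiagonal.antidiagonal n, Ring.choose (n + α) p.1 * ((-x) ^ p.2 / p.2.factorial)

theorem lagL_eq_laguerreSum {α : ℝ} (hα : -1 < α) (n : ℕ) (x : ℝ) :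
    lagL α n x = laguerreSum α n x := by
  rw [laguerreSum, ← Finset.Nat.sum_antidiagonal_swap,
    Finset.Nat.sum_antidiagonal_eq_sum_range_succ_mk, lagL]
  refine Finset.sum_congr rfl fun j hj => ?_
  obtain ⟨i, rfl⟩ := Nat.exists_eq_add_of_le (Nat.lt_succ_iff.1 (Finset.mem_range.1 hj))
  have hz : (0 : ℝ) < j + α + 1 := by
    have : (0 : ℝ) ≤ j := j.cast_nonneg
    linarith
  have h := Gamma_add_nat_eq_multichoose hz i
  rw [Ring.multichoose_eq] at h
  have e2 : ((j + i : ℕ) : ℝ) + α = j + α + 1 + i - 1 := by push_cast; ring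
  have hG := (Real.Gamma_pos_of_pos hz).ne'
  have hf : (i.factorial : ℝ) ≠ 0 := by positivity
  simp only [Prod.swap, Nat.add_sub_cancel_left, e2, sub_add_cancel, h, Real.Gamma_nat_eq_factorial, neg_pow x j]
  field_simp

theorem hasDerivAt_laguerreSum (α : ℝ) (n : ℕ) (x : ℝ) :
    HasDerivAt (laguerreSum α n) (laguerreSum α n x - laguerreSum (α + 1) n x) x := by
  cases n with
  | zero =>
    have h : laguerreSum α 0 = fun _ => 1 := by
      funext y
      simp [laguerreSum]
    rw [h]
    simpa [laguerreSum] using hasDerivAt_const x (1 : ℝ)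
  | succ n =>
    have hv : laguerreSum α (n + 1) x - laguerreSum (α + 1) (n + 1) x =
        ∑ p ∈ Finset.HasAntidiagonal.antidiagonal n,
          Ring.choose (((n + 1 : ℕ) : ℝ) + α) p.1 * (-((-x) ^ p.2 / p.2.factorial)) := by
      simp only [laguerreSum, Finset.Nat.sum_antidiagonal_succ, ← add_assoc,
        Ring.choose_succ_succ, Ring.choose_zero_right]
      rw [add_sub_add_left_eq_sub, ← Finset.sum_sub_distrib]
      exact Finset.sum_congr rfl fun p _ => by ring
    rw [hv]
    have hf : laguerreSum α (n + 1) = fun y =>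
        Ring.choose (((n + 1 : ℕ) : ℝ) + α) (n + 1) +
        ∑ p ∈ Finset.HasAntidiagonal.antidiagonal n,
          Ring.choose (((n + 1 : ℕ) : ℝ) + α) p.1 *
            ((-y) ^ (p.2 + 1) / (p.2 + 1).factorial) := by
      funext y
      simp [laguerreSum, Finset.Nat.sum_antidiagonal_succ']
    rw [hf]
    refine HasDerivAt.const_add _ (HasDerivAt.fun_sum fun p _ => HasDerivAt.const_mul _ ?_)
    refine (((hasDerivAt_neg x).fun_pow (p.2 + 1)).div_const _).congr_deriv ?_
    rw [Nat.factorial_succ]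
    push_cast
    have : (p.2.factorial : ℝ) ≠ 0 := by positivity
    have : (p.2 : ℝ) + 1 ≠ 0 := by positivity
    field_simp

theorem hasDerivAt_exp_mul_laguerreSum (c α : ℝ) (n : ℕ) (y : ℝ) :
    HasDerivAt (fun y => Real.exp (-(c * y)) * laguerreSum α n (c * y))
      (-c * (Real.exp (-(c * y)) * laguerreSum (α + 1) n (c * y))) y := by
  have h1 : HasDerivAt (fun y : ℝ => c * y) c y := by
    simpa using (hasDerivAt_id y).const_mul c
  refine (h1.neg.exp.mul ((hasDerivAt_laguerreSum α n (c * y)).comp y h1)).congr_deriv ?_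
  simp only [Function.comp_apply, Pi.neg_apply]
  ring

theorem iteratedDeriv_exp_mul_laguerreSum (C c α : ℝ) (n k : ℕ) :
    iteratedDeriv k (fun y => C * (Real.exp (-(c * y)) * laguerreSum α n (c * y))) =
      fun y => C * (-c) ^ k * (Real.exp (-(c * y)) * laguerreSum (α + k) n (c * y)) := by
  induction k with
  | zero => simp
  | succ k ih =>
    rw [iteratedDeriv_succ, ih]
    funext y
    rw [((hasDerivAt_exp_mul_laguerreSum c (α + k) n y).const_mul _).deriv, Nat.cast_succ,
      ← add_assoc]
    ring

theorem add_pow_div_factorial (x y : ℝ) (j : ℕ) :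
    (x + y) ^ j / j.factorial = ∑ q ∈ Finset.HasAntidiagonal.antidiagonal j,
      x ^ q.1 / q.1.factorial * (y ^ q.2 / q.2.factorial) := by
  rw [(Commute.all x y).add_pow', Finset.sum_div]
  refine Finset.sum_congr rfl fun q hq => ?_
  rw [Finset.HasAntidiagonal.mem_antidiagonal] at hq
  subst hq
  rw [nsmul_eq_mul, Nat.cast_add_choose]
  have h1 : (q.1.factorial : ℝ) ≠ 0 := by positivity
  have h2 : (q.2.factorial : ℝ) ≠ 0 := by positivity
  have h3 : ((q.1 + q.2).factorial : ℝ) ≠ 0 := by positivity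
  field_simp

/-- The Chu–Vandermonde identity at the level of Laguerre polynomials. -/
theorem laguerreSum_sub (ν s : ℝ) (n : ℕ) (x : ℝ) :
    ∑ p ∈ Finset.HasAntidiagonal.antidiagonal n, Ring.choose (n + ν) p.1 *
      ∑ q ∈ Finset.HasAntidiagonal.antidiagonal p.2, (-x) ^ q.1 / q.1.factorial * Ring.choose (-s) q.2 =
      laguerreSum (ν - s) n x := by
  let A : PowerSeries ℝ := PowerSeries.mk fun i => Ring.choose (n + ν) i
  let B : PowerSeries ℝ := PowerSeries.mk fun i => (-x) ^ i / i.factorial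
  let D : PowerSeries ℝ := PowerSeries.mk fun i => Ring.choose (-s) i
  have hAD : A * D = PowerSeries.mk fun i => Ring.choose (n + (ν - s)) i := by
    ext i
    rw [show (n : ℝ) + (ν - s) = n + ν + -s by ring, PowerSeries.coeff_mk,
      Ring.add_choose_eq i (Commute.all _ _), PowerSeries.coeff_mul]
    simp [A, D]
  have h : PowerSeries.coeff n (A * (B * D)) = PowerSeries.coeff n ((A * D) * B) := by
    congr 1
    ring
  rw [hAD] at h
  simpa [PowerSeries.coeff_mul, A, B, D, laguerreSum] using h

open MeasureTheory Set

theorem integrableOn_rpow_mul_exp_mul_neg_pow {c s : ℝ} (hc : 0 < c) (hs : 0 < s) (q : ℕ) :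
    IntegrableOn (fun u : ℝ => u ^ (s - 1) * Real.exp (-(c * u)) *
      ((-(c * u)) ^ q / q.factorial)) (Ioi 0) ∧
    ∫ u in Ioi (0 : ℝ), u ^ (s - 1) * Real.exp (-(c * u)) * ((-(c * u)) ^ q / q.factorial) =
      c ^ (-s) * Real.Gamma s * Ring.choose (-s) q := by
  have hsq : 0 < s + q := by positivity
  have e : EqOn (fun u : ℝ => (-c) ^ q / q.factorial *
      (u ^ (s + q - 1) * Real.exp (-(c * u)))) (fun u : ℝ => u ^ (s - 1) * Real.exp (-(c * u)) *
      ((-(c * u)) ^ q / q.factorial)) (Ioi 0) := by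
    intro u hu
    have : u ^ (s + q - 1) = u ^ (s - 1) * u ^ q := by
      rw [← Real.rpow_natCast, ← Real.rpow_add hu]
      ring_nf
    simp only [this, ← neg_mul, mul_pow]
    ring
  constructor
  · refine IntegrableOn.congr_fun (Integrable.const_mul ?_ _) e measurableSet_Ioi
    have := integrableOn_rpow_mul_exp_neg_mul_rpow (p := 1) (s := s + q - 1) (b := c)
      (by linarith) one_pos hc
    simpa [IntegrableOn] using this
  · rw [← setIntegral_congr_fun measurableSet_Ioi e, integral_const_mul,
      Real.integral_rpow_mul_exp_neg_mul_Ioi hsq hc, Gamma_add_nat_eq_multichoose hs,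
      choose_neg_real, one_div, Real.inv_rpow hc.le, ← Real.rpow_neg hc.le, neg_add,
      Real.rpow_add hc, Real.rpow_neg hc.le (q : ℝ), Real.rpow_natCast, neg_pow c q]
    have : (q.factorial : ℝ) ≠ 0 := by positivity
    field_simp

theorem integral_rpow_mul_exp_mul_laguerreSum {c s : ℝ} (hc : 0 < c) (hs : 0 < s) (ν : ℝ)
    (n : ℕ) (x : ℝ) :
    ∫ u in Ioi (0 : ℝ), u ^ (s - 1) * Real.exp (-(c * u)) * laguerreSum ν n (x + c * u) =
      c ^ (-s) * Real.Gamma s * laguerreSum (ν - s) n x := by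
  have e (u : ℝ) : u ^ (s - 1) * Real.exp (-(c * u)) * laguerreSum ν n (x + c * u) =
      ∑ p ∈ Finset.HasAntidiagonal.antidiagonal n, ∑ q ∈ Finset.HasAntidiagonal.antidiagonal p.2,
        Ring.choose (n + ν) p.1 * ((-x) ^ q.1 / q.1.factorial) *
          (u ^ (s - 1) * Real.exp (-(c * u)) * ((-(c * u)) ^ q.2 / q.2.factorial)) := by
    simp only [laguerreSum, neg_add, add_pow_div_factorial, Finset.mul_sum]
    refine Finset.sum_congr rfl fun p _ => Finset.sum_congr rfl fun q _ => ?_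
    ring
  have hi (q : ℕ) := integrableOn_rpow_mul_exp_mul_neg_pow hc hs q
  simp only [e]
  rw [integral_finsetSum _ fun p _ => integrable_finsetSum _ fun q _ => (hi q.2).1.const_mul _,
    ← laguerreSum_sub, Finset.mul_sum]
  refine Finset.sum_congr rfl fun p _ => ?_
  rw [integral_finsetSum _ fun q _ => (hi q.2).1.const_mul _, Finset.mul_sum, Finset.mul_sum]
  refine Finset.sum_congr rfl fun q _ => ?_
  rw [integral_const_mul, (hi q.2).2]
  ring

/-- The right tempered fractional integral of a generalized Laguerre function. -/
theorem integral_Ioi_rpow_mul_exp_mul_lagL {c s ν : ℝ} (hc : 0 < c) (hs : 0 < s) (hν : -1 < ν)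
    (n : ℕ) (y : ℝ) :
    1 / Real.Gamma s * ∫ t in Ioi y, (t - y) ^ (s - 1) * (Real.exp (-(c * t)) * lagL ν n (c * t)) =
      c ^ (-s) * (Real.exp (-(c * y)) * laguerreSum (ν - s) n (c * y)) := by
  have h := (measurePreserving_add_right (volume : Measure ℝ) y).setIntegral_preimage_emb
    (measurableEmbedding_addRight y)
    (fun t => (t - y) ^ (s - 1) * (Real.exp (-(c * t)) * lagL ν n (c * t))) (Ioi y)
  rw [← h, preimage_add_const_Ioi, sub_self]
  have e (u : ℝ) : (u + y - y) ^ (s - 1) * (Real.exp (-(c * (u + y))) * lagL ν n (c * (u + y))) =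
      Real.exp (-(c * y)) *
        (u ^ (s - 1) * Real.exp (-(c * u)) * laguerreSum ν n (c * y + c * u)) := by
    rw [add_sub_cancel_right, lagL_eq_laguerreSum hν, mul_add, neg_add, Real.exp_add,
      add_comm (c * y)]
    ring
  simp only [e]
  rw [integral_const_mul, integral_rpow_mul_exp_mul_laguerreSum hc hs]
  have := (Real.Gamma_pos_of_pos hs).ne'
  field_simp

/-- for λ > 0, k ≥ 1, μ ∈ [k−1,k), ν ≥ 0, n ∈ ℕ, x ≥ 0, the right
tempered fractional derivative of order μ of 𝓛_n^{(ν,λ)}(t) = e^{−λt} L_n^{(ν)}(2λt):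
e^{λx} (−1)^k (d/dx)^k [(1/Γ(k−μ)) ∫_y^∞ (t−y)^{k−μ−1} e^{−2λt} L_n^{(ν)}(2λt) dt]|_{y=x}
  = (2λ)^μ e^{−λx} L_n^{(ν+μ)}(2λx). -/
theorem temperedDerivR_GLF (lam : ℝ) (hlam : 0 < lam) (k : ℕ) (hk : 1 ≤ k) (mu : ℝ)
    (hmu1 : (k : ℝ) - 1 ≤ mu) (hmu2 : mu < k) (ν : ℝ) (hν : 0 ≤ ν)
    (n : ℕ) (x : ℝ) (hx : 0 ≤ x) :
    Real.exp (lam * x) * (-1 : ℝ) ^ k *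
        iteratedDeriv k
          (fun y => (1 / Real.Gamma ((k : ℝ) - mu)) *
            ∫ t in Set.Ioi y,
              (t - y) ^ ((k : ℝ) - mu - 1) * (Real.exp (-(2 * lam * t)) * lagL ν n (2 * lam * t))) x
      = (2 * lam) ^ mu * (Real.exp (-(lam * x)) * lagL (ν + mu) n (2 * lam * x)) := by
  have hs : 0 < (k : ℝ) - mu := by linarith
  have hc : 0 < 2 * lam := by linarith
  have hk' : (1 : ℝ) ≤ k := by exact_mod_cast hk
  simp only [integral_Ioi_rpow_mul_exp_mul_lagL hc hs (by linarith : -1 < ν) n]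
  rw [iteratedDeriv_exp_mul_laguerreSum, lagL_eq_laguerreSum (by linarith),
    show ν - (k - mu) + k = ν + mu by ring, neg_sub, Real.rpow_sub hc, Real.rpow_natCast,
    neg_pow (2 * lam) k, show -(lam * x) = lam * x + -(2 * lam * x) by ring, Real.exp_add]
  have h1 : (-1 : ℝ) ^ k * (-1) ^ k = 1 := by rw [← mul_pow]; simp
  have h2 : (2 * lam) ^ k ≠ 0 := by positivity
  beta_reduce
  generalize laguerreSum (ν + mu) n (2 * lam * x) = L
  field_simp
  linear_combination L * h1
end

section
/- Let λ > 0, k ∈ ℕ, ν ∈ ℝ with ν ≥ k, n ∈ ℕ and x > 0. Then the k-th order left tempered derivative of the generalized Laguerre function 𝓛_n^{(−ν,λ)} satisfies e^{−λx} · (the k-th iterated derivative at x of y ↦ y^ν L_n^{(ν)}(2λy)) = (Γ(n+ν+1)/Γ(n+ν−k+1)) · x^{ν−k} e^{−λx} L_n^{(ν−k)}(2λx). -/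
theorem hasDerivAt_rpow_mul_lagL (c : ℝ) {ν : ℝ} (hν : 0 < ν) (n : ℕ) {x : ℝ} (hx : 0 < x) :
    HasDerivAt (fun y => y ^ ν * lagL ν n (c * y))
      (((n : ℝ) + ν) * (x ^ (ν - 1) * lagL (ν - 1) n (c * x))) x := by
  simp only [lagL, Finset.mul_sum]
  refine HasDerivAt.fun_sum fun j _ => ?_
  have hrpow : HasDerivAt (fun y : ℝ => y ^ ν) (ν * x ^ (ν - 1)) x :=
    Real.hasDerivAt_rpow_const (Or.inl hx.ne')
  have hpow : HasDerivAt (fun y : ℝ => (c * y) ^ j) ((j : ℝ) * (c * x) ^ (j - 1) * c) x := by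
    simpa using ((hasDerivAt_id x).const_mul c).fun_pow j
  refine (hrpow.mul ((hpow.const_mul _).div_const _)).congr_deriv ?_
  have hpow_mul : (j : ℝ) * (c * x) ^ (j - 1) * c * x = j * (c * x) ^ j := by
    rcases j with _ | j
    · simp
    · simp only [Nat.add_sub_cancel]
      ring
  have hxν : x ^ ν = x ^ (ν - 1) * x := by
    rw [← Real.rpow_add_one hx.ne', sub_add_cancel]
  have hj : (0 : ℝ) < j + ν := by positivity
  have hn : (0 : ℝ) < n + ν := by positivity
  have hΓj := (Real.Gamma_pos_of_pos hj).ne'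
  have hΓnj : Real.Gamma (((n - j : ℕ) : ℝ) + 1) ≠ 0 :=
    (Real.Gamma_pos_of_pos (by positivity)).ne'
  have hfact : (Nat.factorial j : ℝ) ≠ 0 := by positivity
  rw [show (n : ℝ) + (ν - 1) + 1 = n + ν by ring, show (j : ℝ) + (ν - 1) + 1 = j + ν by ring,
    Real.Gamma_add_one hn.ne', Real.Gamma_add_one hj.ne', hxν]
  field_simp
  linear_combination hpow_mul

/-- for λ > 0, k ∈ ℕ, ν ≥ k, n ∈ ℕ, x > 0, the k-th order left
tempered derivative of 𝓛_n^{(−ν,λ)}(y) = y^ν e^{−λy} L_n^{(ν)}(2λy):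
e^{−λx} (d/dx)^k { x^ν L_n^{(ν)}(2λx) }
  = (Γ(n+ν+1)/Γ(n+ν−k+1)) x^{ν−k} e^{−λx} L_n^{(ν−k)}(2λx). -/
theorem temperedDerivL_nat_GLF (lam : ℝ) (hlam : 0 < lam) (k : ℕ) (ν : ℝ) (hν : (k : ℝ) ≤ ν)
    (n : ℕ) (x : ℝ) (hx : 0 < x) :
    Real.exp (-(lam * x)) * iteratedDeriv k (fun y => y ^ ν * lagL ν n (2 * lam * y)) x
      = (Real.Gamma ((n : ℝ) + ν + 1) / Real.Gamma ((n : ℝ) + ν - k + 1)) *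
          (x ^ (ν - k) * Real.exp (-(lam * x)) * lagL (ν - k) n (2 * lam * x)) := by
  suffices h : iteratedDeriv k (fun y => y ^ ν * lagL ν n (2 * lam * y)) x =
      (Real.Gamma ((n : ℝ) + ν + 1) / Real.Gamma ((n : ℝ) + ν - k + 1)) *
        (x ^ (ν - k) * lagL (ν - k) n (2 * lam * x)) by
    rw [h]
    ring
  induction k generalizing x with
  | zero =>
    have hΓ : Real.Gamma ((n : ℝ) + ν + 1) ≠ 0 := by
      have : 0 ≤ ν := by simpa using hν
      exact (Real.Gamma_pos_of_pos (by positivity)).ne'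
    simp [div_self hΓ]
  | succ k ih =>
    push_cast at hν ⊢
    have hk : 0 < ν - k := by linarith
    have heq : iteratedDeriv k (fun y => y ^ ν * lagL ν n (2 * lam * y)) =ᶠ[nhds x] fun y =>
        (Real.Gamma ((n : ℝ) + ν + 1) / Real.Gamma ((n : ℝ) + ν - k + 1)) *
          (y ^ (ν - k) * lagL (ν - k) n (2 * lam * y)) := by
      filter_upwards [lt_mem_nhds hx] with y hy using ih (by linarith) y hy
    rw [iteratedDeriv_succ, heq.deriv_eq,
      ((hasDerivAt_rpow_mul_lagL (2 * lam) hk n hx).const_mul _).deriv]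
    have hn : (0 : ℝ) < n + ν - k := by
      have : (0 : ℝ) ≤ n := n.cast_nonneg
      linarith
    have hΓ := (Real.Gamma_pos_of_pos hn).ne'
    rw [Real.Gamma_add_one hn.ne', show (n : ℝ) + ν - (k + 1) + 1 = n + ν - k by ring,
      show ν - ((k : ℝ) + 1) = ν - k - 1 by ring, show (n : ℝ) + (ν - k) = n + ν - k by ring]
    field_simp
end

section
/- Let λ > 0, k ∈ ℕ, ν ∈ ℝ with ν ≥ k, n ∈ ℕ and x > 0. Then the k-th order right tempered derivative of the generalized Laguerre function 𝓛_n^{(−ν,λ)} satisfies e^{λx} · (−1)^k · (the k-th iterated derivative at x of y ↦ y^ν e^{−2λy} L_n^{(ν)}(2λy)) = (−1)^k · (Γ(n+k+1)/Γ(n+1)) · x^{ν−k} e^{−λx} L_{n+k}^{(ν−k)}(2λx). -/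
/-- The parameter-lowering relation
`a L_m^{(a)} - x L_m^{(a)} + x (d/dx) L_m^{(a)} = (m + 1) L_{m+1}^{(a-1)}`. -/
theorem exists_hasDerivAt_lagL (a : ℝ) (ha : 0 < a) (m : ℕ) (x : ℝ) :
    ∃ d, HasDerivAt (lagL a m) d x ∧
      a * lagL a m x - x * lagL a m x + x * d = ((m : ℝ) + 1) * lagL (a - 1) (m + 1) x := by
  set C : ℕ → ℝ := fun j => (-1 : ℝ) ^ j * (Real.Gamma ((m : ℝ) + a + 1) /
    (Real.Gamma ((j : ℝ) + a + 1) * Real.Gamma (((m - j : ℕ) : ℝ) + 1))) with hC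
  set D : ℕ → ℝ := fun j => (-1 : ℝ) ^ j * (Real.Gamma (((m + 1 : ℕ) : ℝ) + (a - 1) + 1) /
    (Real.Gamma ((j : ℝ) + (a - 1) + 1) * Real.Gamma (((m + 1 - j : ℕ) : ℝ) + 1)))
    / (Nat.factorial j : ℝ) with hD
  have hL : lagL a m =
      fun y => ∑ j ∈ Finset.range (m + 1), C j * y ^ j / (Nat.factorial j : ℝ) := rfl
  have hR : lagL (a - 1) (m + 1) x = ∑ j ∈ Finset.range (m + 2), D j * x ^ j :=
    Finset.sum_congr rfl fun j _ => by simp only [hD]; ring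
  have htop : (m : ℝ) + 1 + (a - 1) + 1 = m + a + 1 := by ring
  have hlow : ∀ j ∈ Finset.range (m + 1),
      ((m : ℝ) + 1 - j) * D j = (a + j) * (C j / (Nat.factorial j : ℝ)) := by
    intro j hj
    obtain ⟨r, rfl⟩ := Nat.exists_eq_add_of_le (Nat.lt_succ_iff.mp (Finset.mem_range.mp hj))
    have hp : 0 < (j : ℝ) + a := by positivity
    have hG := (Real.Gamma_pos_of_pos hp).ne'
    have h1 : j + r + 1 - j = r + 1 := by lia
    have h2 : j + r - j = r := by lia
    have h3 : (j : ℝ) + (a - 1) + 1 = j + a := by ring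
    have hf : (Nat.factorial j : ℝ) ≠ 0 := by positivity
    have hf' : (Nat.factorial r : ℝ) ≠ 0 := by positivity
    have hr : (r : ℝ) + 1 ≠ 0 := by positivity
    simp only [hC, hD, h1, h2, h3, Real.Gamma_nat_eq_factorial, Real.Gamma_add_one hp.ne',
      Nat.factorial_succ, Nat.cast_mul, Nat.cast_succ, htop]
    push_cast
    field_simp
    ring
  have hshift : ∀ j : ℕ,
      ((j : ℝ) + 1) * D (j + 1) = -(C j / (Nat.factorial j : ℝ)) := by
    intro j
    have h1 : m + 1 - (j + 1) = m - j := by lia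
    have h3 : (j : ℝ) + 1 + (a - 1) + 1 = j + a + 1 := by ring
    have hp : 0 < (j : ℝ) + a + 1 := by positivity
    have hG := (Real.Gamma_pos_of_pos hp).ne'
    have hf : (Nat.factorial j : ℝ) ≠ 0 := by positivity
    have hf' : (Nat.factorial (m - j) : ℝ) ≠ 0 := by positivity
    have hr : (j : ℝ) + 1 ≠ 0 := by positivity
    simp only [hC, hD, h1, Real.Gamma_nat_eq_factorial, Nat.factorial_succ, Nat.cast_mul,
      Nat.cast_succ, htop, h3]
    field_simp
    ring
  refine ⟨∑ j ∈ Finset.range (m + 1), C j * (j * x ^ (j - 1)) / (Nat.factorial j : ℝ), ?_, ?_⟩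
  · rw [hL]
    exact HasDerivAt.fun_sum fun j _ => ((hasDerivAt_pow j x).const_mul (C j)).div_const _
  have hsplit : ((m : ℝ) + 1) * lagL (a - 1) (m + 1) x =
      ∑ j ∈ Finset.range (m + 1), ((m : ℝ) + 1 - j) * D j * x ^ j +
        ∑ j ∈ Finset.range (m + 1), ((j : ℝ) + 1) * D (j + 1) * x ^ (j + 1) := by
    have e1 : ∑ j ∈ Finset.range (m + 2), ((m : ℝ) + 1 - j) * D j * x ^ j =
        ∑ j ∈ Finset.range (m + 1), ((m : ℝ) + 1 - j) * D j * x ^ j := by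
      rw [Finset.sum_range_succ]; push_cast; ring
    have e2 : ∑ j ∈ Finset.range (m + 2), (j : ℝ) * D j * x ^ j =
        ∑ j ∈ Finset.range (m + 1), ((j : ℝ) + 1) * D (j + 1) * x ^ (j + 1) := by
      rw [Finset.sum_range_succ']; push_cast; ring
    rw [← e1, ← e2, hR, Finset.mul_sum, ← Finset.sum_add_distrib]
    exact Finset.sum_congr rfl fun j _ => by ring
  rw [hsplit, hL]
  simp only [Finset.mul_sum]
  rw [← Finset.sum_sub_distrib, ← Finset.sum_add_distrib, ← Finset.sum_add_distrib]
  refine Finset.sum_congr rfl fun j hj => ?_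
  rw [hlow j hj, hshift j]
  rcases j with _ | j
  · simp; ring
  · simp only [Nat.add_sub_cancel]; ring

theorem hasDerivAt_rpow_mul_exp_mul_lagL (c a : ℝ) (ha : 0 < a) (m : ℕ) {y : ℝ} (hy : 0 < y) :
    HasDerivAt (fun y => y ^ a * Real.exp (-(c * y)) * lagL a m (c * y))
      (((m : ℝ) + 1) * (y ^ (a - 1) * Real.exp (-(c * y)) * lagL (a - 1) (m + 1) (c * y))) y := by
  obtain ⟨d, hd, hrel⟩ := exists_hasDerivAt_lagL a ha m (c * y)
  have hlin : HasDerivAt (fun y => c * y) c y := by simpa using (hasDerivAt_id y).const_mul c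
  have hpow : HasDerivAt (fun y : ℝ => y ^ a) (a * y ^ (a - 1)) y :=
    Real.hasDerivAt_rpow_const (Or.inl hy.ne')
  have hsplit : y ^ a = y ^ (a - 1) * y := by
    rw [← Real.rpow_add_one hy.ne', sub_add_cancel]
  refine ((hpow.mul hlin.fun_neg.exp).mul (hd.comp y hlin)).congr_deriv ?_
  simp only [Pi.mul_apply, Function.comp_apply, hsplit]
  linear_combination (y ^ (a - 1) * Real.exp (-(c * y))) * hrel

theorem iteratedDeriv_rpow_mul_exp_mul_lagL (c ν : ℝ) (n k : ℕ) (hν : (k : ℝ) ≤ ν) {x : ℝ}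
    (hx : 0 < x) :
    iteratedDeriv k (fun y => y ^ ν * Real.exp (-(c * y)) * lagL ν n (c * y)) x =
      Real.Gamma ((n : ℝ) + k + 1) / Real.Gamma ((n : ℝ) + 1) *
        (x ^ (ν - k) * Real.exp (-(c * x)) * lagL (ν - k) (n + k) (c * x)) := by
  induction k generalizing x with
  | zero =>
    have hG : Real.Gamma ((n : ℝ) + 1) ≠ 0 := (Real.Gamma_pos_of_pos (by positivity)).ne'
    simp [hG]
  | succ k ih =>
    push_cast at hν
    have hev := Filter.eventuallyEq_of_mem (Ioi_mem_nhds hx)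
      fun y (hy : 0 < y) => ih (by linarith) hy
    have hder := (hasDerivAt_rpow_mul_exp_mul_lagL c (ν - k) (by linarith) (n + k) hx).const_mul
      (Real.Gamma ((n : ℝ) + k + 1) / Real.Gamma ((n : ℝ) + 1))
    rw [iteratedDeriv_succ, hev.deriv_eq, hder.deriv]
    have hG : Real.Gamma ((n : ℝ) + (k + 1) + 1) = (n + k + 1) * Real.Gamma ((n : ℝ) + k + 1) := by
      rw [← Real.Gamma_add_one (by positivity), add_assoc (n : ℝ) k 1]
    push_cast
    rw [hG, ← sub_sub, add_assoc n k 1]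
    ring

/-- for λ > 0, k ∈ ℕ, ν ≥ k, n ∈ ℕ, x > 0, the k-th order right
tempered derivative of 𝓛_n^{(−ν,λ)}(y) = y^ν e^{−λy} L_n^{(ν)}(2λy):
e^{λx} (−1)^k (d/dx)^k { x^ν e^{−2λx} L_n^{(ν)}(2λx) }
  = (−1)^k (Γ(n+k+1)/Γ(n+1)) x^{ν−k} e^{−λx} L_{n+k}^{(ν−k)}(2λx). -/
theorem temperedDerivR_nat_GLF (lam : ℝ) (hlam : 0 < lam) (k : ℕ) (ν : ℝ) (hν : (k : ℝ) ≤ ν)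
    (n : ℕ) (x : ℝ) (hx : 0 < x) :
    Real.exp (lam * x) * (-1 : ℝ) ^ k *
        iteratedDeriv k (fun y => y ^ ν * Real.exp (-(2 * lam * y)) * lagL ν n (2 * lam * y)) x
      = (-1 : ℝ) ^ k * (Real.Gamma ((n : ℝ) + k + 1) / Real.Gamma ((n : ℝ) + 1)) *
          (x ^ (ν - k) * Real.exp (-(lam * x)) * lagL (ν - k) (n + k) (2 * lam * x)) := by
  rw [iteratedDeriv_rpow_mul_exp_mul_lagL (2 * lam) ν n k hν hx]
  have hexp : Real.exp (-(lam * x)) = Real.exp (lam * x) * Real.exp (-(2 * lam * x)) := by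
    rw [← Real.exp_add]; congr 1; ring
  rw [hexp]
  ring
end

section
/- (Coefficient form of the GLF approximation estimate, Theorem 3.6.) Let λ > 0, ν > 0, and m, N ∈ ℕ with m ≤ N + 1. For a > −1 and n ∈ ℕ set γ_n^{a} := Γ(n+a+1)/((2λ)^{a+1} Γ(n+1)), and set d_n := (2λ)^m · Γ(n+1+ν)/Γ(n+1). Then for every real sequence (û_n)_{n≥0} such that ∑_{n=N+1}^∞ û_n² d_n² γ_{n−m}^{m} converges, one has ∑_{n=N+1}^∞ û_n² γ_n^{ν} ≤ ( Γ(N+2−m) / ((2λ)^{ν+m} Γ(N+2+ν)) ) · ∑_{n=N+1}^∞ û_n² d_n² γ_{n−m}^{m}. (Here ∑_{n=N+1}^∞ û_n² γ_n^{ν} = ‖π_N^{−ν,λ}u − u‖²_{ω^{−ν}} and ∑ û_n² d_n² γ_{n−m}^{m} = ‖TD₀^{ν+m,λ}u‖²_{ω^{m}} when û_n are the expansion coefficients of u in the generalized Laguerre functions 𝓛_n^{(−ν,λ)}.) -/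
/-- γ_n^{a} = Γ(n+a+1)/((2λ)^{a+1} Γ(n+1)), the squared weighted L²-norm of the
generalized Laguerre function 𝓛_n^{(−a,λ)}. -/
noncomputable def glfNormSq (lam a : ℝ) (n : ℕ) : ℝ :=
  Real.Gamma ((n : ℝ) + a + 1) / ((2 * lam) ^ (a + 1) * Real.Gamma ((n : ℝ) + 1))

/-- d_n = (2λ)^m · Γ(n+1+ν)/Γ(n+1). -/
noncomputable def glfDerivCoef (lam ν : ℝ) (m n : ℕ) : ℝ :=
  (2 * lam) ^ m * (Real.Gamma ((n : ℝ) + 1 + ν) / Real.Gamma ((n : ℝ) + 1))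

/-- For `0 < x ≤ y` the ratio `Γ(x + j) / Γ(y + j)` is at most `Γ(x) / Γ(y)`. -/
theorem gamma_add_nat_div_le {x y : ℝ} (hx : 0 < x) (hxy : x ≤ y) (j : ℕ) :
    Real.Gamma (x + j) / Real.Gamma (y + j) ≤ Real.Gamma x / Real.Gamma y := by
  induction j with
  | zero => simp
  | succ j ih =>
    have hxj : 0 < x + j := by positivity
    have hyj : 0 < y + j := by linarith
    have hΓx := Real.Gamma_pos_of_pos hxj
    have hΓy := Real.Gamma_pos_of_pos hyj
    push_cast
    rw [← add_assoc, ← add_assoc, Real.Gamma_add_one hxj.ne', Real.Gamma_add_one hyj.ne',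
      mul_div_mul_comm]
    refine le_trans ?_ ih
    refine mul_le_of_le_one_left (by positivity) ?_
    rw [div_le_one hyj]
    linarith

theorem glfNormSq_nonneg {lam a : ℝ} (hlam : 0 < lam) (ha : 0 ≤ a) (n : ℕ) :
    0 ≤ glfNormSq lam a n := by
  have h₁ := Real.Gamma_pos_of_pos (show 0 < (n : ℝ) + a + 1 by positivity)
  have h₂ := Real.Gamma_pos_of_pos (show 0 < (n : ℝ) + 1 by positivity)
  unfold glfNormSq
  positivity

/-- The squared norms of a generalized Laguerre function and of its `m`-th tempered derivative
differ by the factor `Γ(n - m + 1) / ((2λ)^(ν + m) Γ(n + 1 + ν))`. -/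
theorem glfNormSq_eq_mul_glfDerivCoef_sq {lam ν : ℝ} (hlam : 0 < lam) (hν : 0 < ν) {m n : ℕ}
    (hmn : m ≤ n) :
    glfNormSq lam ν n =
      Real.Gamma ((n : ℝ) - m + 1) / Real.Gamma ((n : ℝ) + 1 + ν) / (2 * lam) ^ (ν + m) *
        (glfDerivCoef lam ν m n ^ 2 * glfNormSq lam (m : ℝ) (n - m)) := by
  have hc : 0 < 2 * lam := by positivity
  have hmn' : (m : ℝ) ≤ n := by exact_mod_cast hmn
  have h₁ : Real.Gamma ((n : ℝ) - m + 1) ≠ 0 := (Real.Gamma_pos_of_pos (by linarith)).ne'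
  have h₂ : Real.Gamma ((n : ℝ) + 1 + ν) ≠ 0 := (Real.Gamma_pos_of_pos (by positivity)).ne'
  have h₃ : Real.Gamma ((n : ℝ) + 1) ≠ 0 := (Real.Gamma_pos_of_pos (by positivity)).ne'
  have h₄ : (2 * lam) ^ ν ≠ 0 := (Real.rpow_pos_of_pos hc ν).ne'
  have h₅ : (2 * lam) ^ m ≠ 0 := (pow_pos hc m).ne'
  unfold glfNormSq glfDerivCoef
  rw [Nat.cast_sub hmn, sub_add_cancel, add_right_comm (n : ℝ) ν 1, Real.rpow_add hc,
    Real.rpow_add hc, Real.rpow_add hc, Real.rpow_one, Real.rpow_natCast]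
  field_simp

/-- coefficient form of the GLF approximation estimate: for λ > 0,
ν > 0, m ≤ N + 1 and any real sequence (û_n) with
∑_{n=N+1}^∞ û_n² d_n² γ_{n−m}^{m} convergent,
∑_{n=N+1}^∞ û_n² γ_n^{ν}
  ≤ (Γ(N+2−m)/((2λ)^{ν+m} Γ(N+2+ν))) · ∑_{n=N+1}^∞ û_n² d_n² γ_{n−m}^{m}. -/
theorem glf_approximation_coeff (lam ν : ℝ) (hlam : 0 < lam) (hν : 0 < ν)
    (m N : ℕ) (hm : m ≤ N + 1) (u : ℕ → ℝ)
    (hsum : Summable (fun j : ℕ =>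
      (u (N + 1 + j)) ^ 2 * (glfDerivCoef lam ν m (N + 1 + j)) ^ 2 *
        glfNormSq lam (m : ℝ) (N + 1 + j - m))) :
    (∑' j : ℕ, (u (N + 1 + j)) ^ 2 * glfNormSq lam ν (N + 1 + j)) ≤
      (Real.Gamma ((N : ℝ) + 2 - m) / ((2 * lam) ^ (ν + m) * Real.Gamma ((N : ℝ) + 2 + ν))) *
        ∑' j : ℕ, (u (N + 1 + j)) ^ 2 * (glfDerivCoef lam ν m (N + 1 + j)) ^ 2 *
          glfNormSq lam (m : ℝ) (N + 1 + j - m) := by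
  have hmN : (m : ℝ) ≤ N + 1 := by exact_mod_cast hm
  have hterm : ∀ j : ℕ, u (N + 1 + j) ^ 2 * glfNormSq lam ν (N + 1 + j) ≤
      (Real.Gamma ((N : ℝ) + 2 - m) / ((2 * lam) ^ (ν + m) * Real.Gamma ((N : ℝ) + 2 + ν))) *
        (u (N + 1 + j) ^ 2 * glfDerivCoef lam ν m (N + 1 + j) ^ 2 *
          glfNormSq lam (m : ℝ) (N + 1 + j - m)) := fun j => by
    have hratio := gamma_add_nat_div_le (x := (N : ℝ) + 2 - m) (y := (N : ℝ) + 2 + ν)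
      (by linarith) (by linarith [(Nat.cast_nonneg m : (0 : ℝ) ≤ m)]) j
    have e₁ : ((N + 1 + j : ℕ) : ℝ) - m + 1 = (N : ℝ) + 2 - m + j := by push_cast; ring
    have e₂ : ((N + 1 + j : ℕ) : ℝ) + 1 + ν = (N : ℝ) + 2 + ν + j := by push_cast; ring
    rw [glfNormSq_eq_mul_glfDerivCoef_sq hlam hν (hm.trans (Nat.le_add_right _ j)), e₁, e₂,
      mul_left_comm, ← mul_assoc (u _ ^ 2), mul_comm ((2 * lam) ^ (ν + m)), ← div_div]
    have := glfNormSq_nonneg hlam m.cast_nonneg (N + 1 + j - m)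
    gcongr
  rw [← tsum_mul_left]
  have hsum' := hsum.mul_left
    (Real.Gamma ((N : ℝ) + 2 - m) / ((2 * lam) ^ (ν + m) * Real.Gamma ((N : ℝ) + 2 + ν)))
  have hnonneg : ∀ j : ℕ, 0 ≤ u (N + 1 + j) ^ 2 * glfNormSq lam ν (N + 1 + j) := fun j =>
    mul_nonneg (sq_nonneg _) (glfNormSq_nonneg hlam hν.le _)
  exact (hsum'.of_nonneg_of_le hnonneg hterm).tsum_le_tsum hterm hsum'
end
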